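/- arXiv:2401.08377 — 2 statements merged into one kernel-verified Lean document; each statement's English description precedes it below -/
import Mathlib

section
/- For open MDPs 𝒜, ℬ whose sequential composition 𝒜⨟ℬ is well-defined: the family of achievable sets of 𝒜⨟ℬ equals the family of achievable sets of D(A^𝒜)⨟D(A^ℬ); that is, for every entrance i of 𝒜⨟ℬ, A^{𝒜⨟ℬ}(i) = A^{D(A^𝒜)⨟D(A^ℬ)}(i), where A^𝒜 and A^ℬ are the families of achievable sets of 𝒜 and ℬ and D(·) denotes the shortcut oMDP construction. -/
open scoped Classical ENNReal

namespace SD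

/-- A Markov decision process with finite sets of states and actions: a partial
transition function assigning to a state and an action a probability
distribution over states. -/
structure MDP (S A : Type) : Type where
  P : S → A → Option (S → ℝ)

namespace MDP

variable {S A : Type} [Fintype S] [Fintype A]

/-- All defined transitions are genuine probability distributions. -/
def Proper (M : MDP S A) : Prop :=
  ∀ s a d, M.P s a = some d → (∀ s', 0 ≤ d s') ∧ ∑ s', d s' = 1

/-- The action `a` is enabled in `s`. -/
def enabled (M : MDP S A) (s : S) (a : A) : Prop := M.P s a ≠ none

/-- A state is terminal if no action is enabled in it. -/
def terminal (M : MDP S A) (s : S) : Prop := ∀ a, M.P s a = none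

/-- Transition probabilities. -/
noncomputable def prob (M : MDP S A) (s : S) (a : A) (s' : S) : ℝ :=
  (M.P s a).elim 0 fun d => d s'

end MDP

/-- A finite path of an MDP: a start state with a list of (action, next state) steps. -/
structure FinPath (S A : Type) : Type where
  start : S
  steps : List (A × S)

namespace FinPath

/-- The last state of a finite path. -/
def last {S A : Type} (π : FinPath S A) : S := (π.steps.map Prod.snd).getLastD π.start

/-- Extending a finite path by one step. -/
def snoc {S A : Type} (π : FinPath S A) (a : A) (s : S) : FinPath S A :=
  ⟨π.start, π.steps ++ [(a, s)]⟩

end FinPath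

namespace MDP

variable {S A : Type} [Fintype S] [Fintype A]

/-- Consistency of a sequence of steps with the transitions, from a given state. -/
def ConsistentFrom (M : MDP S A) : S → List (A × S) → Prop
  | _, [] => True
  | s, (a, s') :: l => M.prob s a s' ≠ 0 ∧ ConsistentFrom M s' l

/-- A finite path is consistent if every step has nonzero probability. -/
def Consistent (M : MDP S A) (π : FinPath S A) : Prop := M.ConsistentFrom π.start π.steps

end MDP

/-- A (history-dependent, stochastic) scheduler, given by its raw weights. -/
abbrev Sched (S A : Type) : Type := FinPath S A → A → ℝ

namespace MDP

variable {S A : Type} [Fintype S] [Fintype A]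

/-- `σ` is a scheduler for `M`: it assigns to every (consistent) finite path a
probability distribution over the actions enabled in its last state. -/
def IsSched (M : MDP S A) (σ : Sched S A) : Prop :=
  ∀ π : FinPath S A, M.Consistent π →
    (∀ a, 0 ≤ σ π a) ∧ (∀ a, σ π a ≠ 0 → M.enabled π.last a) ∧
      (¬M.terminal π.last → ∑ a, σ π a = 1)

end MDP

/-- Memoryless schedulers depend only on the last state of a path. -/
def Memoryless {S A : Type} (σ : Sched S A) : Prop :=
  ∀ π π' : FinPath S A, π.last = π'.last → σ π = σ π'

/-- Deterministic schedulers choose Dirac distributions. -/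
def Deterministic {S A : Type} (σ : Sched S A) : Prop := ∀ π a, σ π a = 0 ∨ σ π a = 1

/-- Deterministic memoryless (DM) schedulers. -/
def DM {S A : Type} (σ : Sched S A) : Prop := Memoryless σ ∧ Deterministic σ

namespace MDP

variable {S A : Type} [Fintype S] [Fintype A]

/-- Probability of visiting `T` within `n` steps (terminal states made absorbing),
starting from the history `π`, under the scheduler `σ`. -/
noncomputable def reachN (M : MDP S A) (σ : Sched S A) (T : Set S) :
    ℕ → FinPath S A → ℝ
  | 0, π => if π.last ∈ T then 1 else 0
  | n + 1, π =>
      if π.last ∈ T then 1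
      else ∑ a : A, σ π a * ∑ s' : S, M.prob π.last a s' * reachN M σ T n (π.snoc a s')

/-- `Pr^{M,σ}(s ⊨ ◇T)`: the probability, under the measure on infinite paths induced
by `σ` from `s` (terminal states made absorbing), of the paths that visit `T`; it is
the supremum of the bounded-horizon reachability probabilities. -/
noncomputable def Pr (M : MDP S A) (σ : Sched S A) (s : S) (T : Set S) : ℝ :=
  ⨆ n : ℕ, M.reachN σ T n ⟨s, []⟩

end MDP

/-- An open MDP: an MDP together with (totally ordered, given as lists) sets of
rightward/leftward entrances and exits. -/
structure OMDP (S A : Type) : Type where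
  M : MDP S A
  Ir : List S
  Il : List S
  Or : List S
  Ol : List S

namespace OMDP

variable {S A : Type}

/-- The entrances `I = I_r ∪ I_l`. -/
def entr (𝒜 : OMDP S A) : List S := 𝒜.Ir ++ 𝒜.Il

/-- The exits `O = O_r ∪ O_l`. -/
def exit (𝒜 : OMDP S A) : List S := 𝒜.Or ++ 𝒜.Ol

/-- The index type of exits. -/
abbrev ExitIdx (𝒜 : OMDP S A) : Type := {s : S // s ∈ 𝒜.exit}

/-- The index type of entrances. -/
abbrev EntrIdx (𝒜 : OMDP S A) : Type := {s : S // s ∈ 𝒜.entr}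

variable [Fintype S] [Fintype A]

/-- Well-formedness of an open MDP: the transitions are probability
distributions, the open ends are pairwise disjoint (each without duplicates),
and the exits are exactly the terminal states. -/
def WF (𝒜 : OMDP S A) : Prop :=
  𝒜.M.Proper ∧ (𝒜.Ir ++ 𝒜.Il ++ 𝒜.Or ++ 𝒜.Ol).Nodup ∧
    ∀ s : S, s ∈ 𝒜.exit ↔ 𝒜.M.terminal s

/-- `Pr^{𝒜,σ}(i ⊨ ◇O) ∈ ℝ^O`: the vector of reachability probabilities to each exit. -/
noncomputable def prVec (𝒜 : OMDP S A) (σ : Sched S A) (i : S) : 𝒜.ExitIdx → ℝ :=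
  fun j => 𝒜.M.Pr σ i {j.1}

/-- The set `A^𝒜(i)` of achievable points from `i`. -/
def achievable (𝒜 : OMDP S A) (i : S) : Set (𝒜.ExitIdx → ℝ) :=
  {p | ∃ σ : Sched S A, 𝒜.M.IsSched σ ∧ p ≤ 𝒜.prVec σ i}

/-- The set `A^{𝒜,Σ}(i)` of points achievable from `i` by schedulers in the class `C`. -/
def achievableBy (𝒜 : OMDP S A) (i : S) (C : Sched S A → Prop) : Set (𝒜.ExitIdx → ℝ) :=
  {p | ∃ σ : Sched S A, 𝒜.M.IsSched σ ∧ C σ ∧ p ≤ 𝒜.prVec σ i}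

/-- The Pareto curve `𝒮(𝒜, i)`: achievable points not strictly dominated by an
achievable point. -/
def pareto (𝒜 : OMDP S A) (i : S) : Set (𝒜.ExitIdx → ℝ) :=
  {p | p ∈ 𝒜.achievable i ∧ ∀ q ∈ 𝒜.achievable i, p ≤ q → q = p}

end OMDP

/-- Downward closure. -/
def dw {ι : Type} (X : Set (ι → ℝ)) : Set (ι → ℝ) := {p | ∃ q ∈ X, p ≤ q}

/-- Downward convex closure. -/
def dwConv {ι : Type} (X : Set (ι → ℝ)) : Set (ι → ℝ) := dw (convexHull ℝ X)

/-- Subdistributions on `ι`: nonnegative points with coordinate sum at most 1. -/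
def Subdist {ι : Type} [Fintype ι] (p : ι → ℝ) : Prop :=
  (∀ j, 0 ≤ p j) ∧ ∑ j, p j ≤ 1

end SD

namespace SD

namespace OMDP

variable {S A : Type} [Fintype S] [Fintype A]

/-- The actions of a shortcut oMDP for the family `B`: the union of the `B i`. -/
abbrev ShortAct (𝒜 : OMDP S A) (B : 𝒜.EntrIdx → Finset (𝒜.ExitIdx → ℝ)) : Type :=
  {p : 𝒜.ExitIdx → ℝ // ∃ i, p ∈ B i}

noncomputable instance instFintypeShortAct (𝒜 : OMDP S A)
    (B : 𝒜.EntrIdx → Finset (𝒜.ExitIdx → ℝ)) : Fintype (ShortAct 𝒜 B) := by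
  have h : {p : 𝒜.ExitIdx → ℝ | ∃ i, p ∈ B i}.Finite := by
    have he : {p : 𝒜.ExitIdx → ℝ | ∃ i, p ∈ B i} =
        ⋃ i, ((B i : Finset (𝒜.ExitIdx → ℝ)) : Set (𝒜.ExitIdx → ℝ)) := by
      ext p; simp
    rw [he]
    exact Set.finite_iUnion fun i => (B i).finite_toSet
  exact h.fintype

/-- The shortcut oMDP `D(B)` of a family `B = (B_i)_{i ∈ I}` of finite sets of
subdistributions on the exits: states are the entrances and exits of `𝒜`
together with a fresh sink `⋆` (encoded by `Option S`, with `⋆ = none`), actions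
are the points in the `B_i`, and from entrance `i` the action `p ∈ B_i` moves to
exit `o` with probability `p(o)` and to `⋆` with the remaining probability
`1 - Σ_o p(o)`. -/
noncomputable def shortcut (𝒜 : OMDP S A) (B : 𝒜.EntrIdx → Finset (𝒜.ExitIdx → ℝ)) :
    OMDP (Option S) (ShortAct 𝒜 B) where
  M := ⟨fun t a =>
    match t with
    | none => none
    | some s =>
        if _h : ∃ hs : s ∈ 𝒜.entr, a.1 ∈ B ⟨s, hs⟩ then
          some fun t' =>
            match t' with
            | none => 1 - ∑ j : 𝒜.ExitIdx, a.1 j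
            | some s' => ∑ j : 𝒜.ExitIdx, if j.1 = s' then a.1 j else 0
        else none⟩
  Ir := 𝒜.Ir.map some
  Il := 𝒜.Il.map some
  Or := 𝒜.Or.map some
  Ol := 𝒜.Ol.map some

end OMDP

/-- Transporting points in `ℝ^{O_𝒴}` to points in `ℝ^{O_𝒳}` along a map of exits. -/
def pullExit {S₁ A₁ S₂ A₂ : Type} (𝒳 : OMDP S₁ A₁) (𝒴 : OMDP S₂ A₂) (f : S₁ → S₂)
    (hf : ∀ s ∈ 𝒳.exit, f s ∈ 𝒴.exit) (p : 𝒴.ExitIdx → ℝ) : 𝒳.ExitIdx → ℝ :=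
  fun j => p ⟨f j.1, hf j.1 j.2⟩

end SD

namespace SD

namespace OMDP

variable {S₁ A₁ S₂ A₂ : Type}

/-- The sequential composition `𝒜 ⨟ ℬ` of type-matching open MDPs: the disjoint
union of the two oMDPs in which the `i`-th rightward exit of `𝒜` moves with
probability 1 to the `i`-th rightward entrance of `ℬ` and the `i`-th leftward
exit of `ℬ` moves with probability 1 to the `i`-th leftward entrance of `𝒜`;
its entrances are `(I_r^𝒜, I_l^ℬ)` and its exits are `(O_r^ℬ, O_l^𝒜)`. -/
noncomputable def seqComp (𝒜 : OMDP S₁ A₁) (ℬ : OMDP S₂ A₂)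
    (h₁ : 𝒜.Or.length = ℬ.Ir.length) (h₂ : ℬ.Ol.length = 𝒜.Il.length) :
    OMDP (S₁ ⊕ S₂) (A₁ ⊕ A₂) where
  M := ⟨fun t a =>
    match t with
    | Sum.inl s =>
        if h : ∃ k : Fin 𝒜.Or.length, 𝒜.Or.get k = s then
          some fun t' => if t' = Sum.inr (ℬ.Ir.get (Fin.cast h₁ h.choose)) then 1 else 0
        else
          match a with
          | Sum.inl a => (𝒜.M.P s a).map fun d => Sum.elim d fun _ => 0
          | Sum.inr _ => none
    | Sum.inr s =>
        if h : ∃ k : Fin ℬ.Ol.length, ℬ.Ol.get k = s then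
          some fun t' => if t' = Sum.inl (𝒜.Il.get (Fin.cast h₂ h.choose)) then 1 else 0
        else
          match a with
          | Sum.inr a => (ℬ.M.P s a).map fun d => Sum.elim (fun _ => 0) d
          | Sum.inl _ => none⟩
  Ir := 𝒜.Ir.map Sum.inl
  Il := ℬ.Il.map Sum.inr
  Or := ℬ.Or.map Sum.inr
  Ol := 𝒜.Ol.map Sum.inl

/-- The sequential composition `σ₁ ⨟ σ₂` of memoryless schedulers on `𝒜` and `ℬ`:
it behaves like `σ₁` on the states of `𝒜` and like `σ₂` on the states of `ℬ`
(on the connecting exits, where all actions induce the same probability-1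
transition, it plays uniformly). -/
noncomputable def schedSeqComp [Fintype A₁] [Fintype A₂] (𝒜 : OMDP S₁ A₁) (ℬ : OMDP S₂ A₂)
    (σ₁ : Sched S₁ A₁) (σ₂ : Sched S₂ A₂) : Sched (S₁ ⊕ S₂) (A₁ ⊕ A₂) := fun π a =>
  match π.last, a with
  | Sum.inl s, a =>
      if s ∈ 𝒜.Or then ((Fintype.card (A₁ ⊕ A₂) : ℝ))⁻¹
      else
        match a with
        | Sum.inl a => σ₁ ⟨s, []⟩ a
        | Sum.inr _ => 0
  | Sum.inr s, a =>
      if s ∈ ℬ.Ol then ((Fintype.card (A₁ ⊕ A₂) : ℝ))⁻¹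
      else
        match a with
        | Sum.inr a => σ₂ ⟨s, []⟩ a
        | Sum.inl _ => 0

/-- The restriction of a (memoryless) scheduler on `𝒜 ⨟ ℬ` to the states of `𝒜`. -/
noncomputable def restrictL [Fintype S₁] [Fintype A₁] (𝒜 : OMDP S₁ A₁)
    (τ : Sched (S₁ ⊕ S₂) (A₁ ⊕ A₂)) : Sched S₁ A₁ := fun π a =>
  if 𝒜.M.terminal π.last then 0 else τ ⟨Sum.inl π.last, []⟩ (Sum.inl a)

/-- The restriction of a (memoryless) scheduler on `𝒜 ⨟ ℬ` to the states of `ℬ`. -/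
noncomputable def restrictR [Fintype S₂] [Fintype A₂] (ℬ : OMDP S₂ A₂)
    (τ : Sched (S₁ ⊕ S₂) (A₁ ⊕ A₂)) : Sched S₂ A₂ := fun π a =>
  if ℬ.M.terminal π.last then 0 else τ ⟨Sum.inr π.last, []⟩ (Sum.inr a)

end OMDP

end SD

namespace SD

open Filter Topology

@[simp]
theorem FinPath.last_nil {S A : Type} (s : S) : (⟨s, []⟩ : FinPath S A).last = s := rfl

@[simp]
theorem FinPath.last_snoc {S A : Type} (π : FinPath S A) (a : A) (s : S) :
    (π.snoc a s).last = s := by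
  simp [FinPath.last, FinPath.snoc, List.getLastD_eq_getLast?]

namespace MDP

variable {S A : Type}

theorem terminal.prob_eq_zero {M : MDP S A} {s : S} (h : M.terminal s) (a : A) (s' : S) :
    M.prob s a s' = 0 := by
  simp [prob, h a]

theorem ConsistentFrom.append {M : MDP S A} {a : A} {s' : S} (l : List (A × S)) :
    ∀ s : S, M.ConsistentFrom s l → M.prob ((l.map Prod.snd).getLastD s) a s' ≠ 0 →
      M.ConsistentFrom s (l ++ [(a, s')]) := by
  induction l with
  | nil => intro s _ h; exact ⟨h, trivial⟩
  | cons x l ih =>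
    intro s h h'
    refine ⟨h.1, ih _ h.2 ?_⟩
    simpa [List.getLastD_eq_getLast?, List.getLast?_cons] using h'

theorem Consistent.snoc {M : MDP S A} {π : FinPath S A} (hπ : M.Consistent π) {a : A} {s : S}
    (h : M.prob π.last a s ≠ 0) : M.Consistent (π.snoc a s) :=
  ConsistentFrom.append π.steps π.start hπ h

theorem consistent_nil (M : MDP S A) (s : S) : M.Consistent ⟨s, []⟩ := trivial

theorem IsSched.sum_le [Fintype A] {M : MDP S A} {σ : Sched S A} (hσ : M.IsSched σ) {π : FinPath S A}
    (hπ : M.Consistent π) : ∑ a, σ π a ≤ 1 := by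
  by_cases ht : M.terminal π.last
  · rw [Finset.sum_eq_zero]
    · exact zero_le_one
    · intro a _
      by_contra h
      exact (hσ π hπ).2.1 a h (ht a)
  · exact ((hσ π hπ).2.2 ht).le

/-- `δ` selects an enabled action in every non-terminal state. -/
def IsSelector (M : MDP S A) (δ : S → Option A) : Prop :=
  ∀ s, (∀ a, δ s = some a → M.enabled s a) ∧ (¬M.terminal s → δ s ≠ none)

/-- The deterministic memoryless scheduler playing according to `δ`. -/
noncomputable def selSched (δ : S → Option A) : Sched S A :=
  fun π a => if δ π.last = some a then 1 else 0

theorem sum_selSched_mul [Fintype A] (δ : S → Option A) (π : FinPath S A) (f : A → ℝ) :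
    ∑ a, selSched δ π a * f a = (δ π.last).elim 0 f := by
  unfold selSched
  cases δ π.last <;> simp

theorem IsSelector.isSched [Fintype A] {M : MDP S A} {δ : S → Option A} (hδ : M.IsSelector δ) :
    M.IsSched (selSched δ) := by
  intro π _
  refine ⟨fun a => ?_, fun a ha => ?_, fun ht => ?_⟩
  · unfold selSched; split_ifs <;> norm_num
  · refine (hδ π.last).1 a ?_
    by_contra h
    exact ha (by simp [selSched, h])
  · obtain ⟨a, ha⟩ := Option.ne_none_iff_exists'.1 ((hδ π.last).2 ht)
    simp [selSched, ha]

variable [Fintype S]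

/-- All transition rows are subdistributions. -/
structure SubProper (M : MDP S A) : Prop where
  nonneg : ∀ s a s', 0 ≤ M.prob s a s'
  sum_le : ∀ s a, ∑ s', M.prob s a s' ≤ 1

theorem Proper.subProper {M : MDP S A} (h : M.Proper) : M.SubProper := by
  constructor
  · intro s a s'
    unfold prob
    cases hd : M.P s a with
    | none => simp
    | some d => simpa using (h s a d hd).1 s'
  · intro s a
    unfold prob
    cases hd : M.P s a with
    | none => simp
    | some d => simpa using (h s a d hd).2.le

/-- The expected value of `g` after playing `a` in `s`. -/
noncomputable def backup (M : MDP S A) (s : S) (a : A) (g : S → ℝ) : ℝ :=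
  ∑ s', M.prob s a s' * g s'

theorem terminal.backup_eq_zero {M : MDP S A} {s : S} (h : M.terminal s) (a : A) (g : S → ℝ) :
    M.backup s a g = 0 := by
  simp [backup, h.prob_eq_zero]

theorem backup_eq_zero_of_not_enabled {M : MDP S A} {s : S} {a : A} (h : ¬M.enabled s a)
    (g : S → ℝ) : M.backup s a g = 0 := by
  simp only [enabled, ne_eq, not_not] at h
  simp [backup, prob, h]

theorem SubProper.backup_mono {M : MDP S A} (hM : M.SubProper) (s : S) (a : A) {g g' : S → ℝ}
    (h : ∀ s', M.prob s a s' ≠ 0 → g s' ≤ g' s') : M.backup s a g ≤ M.backup s a g' := by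
  refine Finset.sum_le_sum fun s' _ => ?_
  by_cases h0 : M.prob s a s' = 0
  · simp [h0]
  · exact mul_le_mul_of_nonneg_left (h s' h0) (hM.nonneg s a s')

theorem SubProper.backup_nonneg {M : MDP S A} (hM : M.SubProper) (s : S) (a : A) {g : S → ℝ}
    (h : ∀ s', M.prob s a s' ≠ 0 → 0 ≤ g s') : 0 ≤ M.backup s a g := by
  simpa [backup] using hM.backup_mono s a (g := 0) (g' := g) h

theorem SubProper.backup_const_le {M : MDP S A} (hM : M.SubProper) (s : S) (a : A) {c : ℝ}
    (hc : 0 ≤ c) : M.backup s a (fun _ => c) ≤ c := by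
  simpa [backup, ← Finset.sum_mul] using mul_le_mul_of_nonneg_right (hM.sum_le s a) hc

theorem backup_add (M : MDP S A) (s : S) (a : A) (g g' : S → ℝ) :
    M.backup s a (fun s' => g s' + g' s') = M.backup s a g + M.backup s a g' := by
  simp [backup, mul_add, Finset.sum_add_distrib]

theorem backup_const_mul (M : MDP S A) (s : S) (a : A) (c : ℝ) (g : S → ℝ) :
    M.backup s a (fun s' => c * g s') = c * M.backup s a g := by
  simp only [backup, Finset.mul_sum]
  exact Finset.sum_congr rfl fun _ _ => by ring

variable [Fintype A]

/-- The expected `w`-reward upon termination within `n` steps, after the history `π`. -/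
noncomputable def rewardN (M : MDP S A) (σ : Sched S A) (w : S → ℝ) (n : ℕ)
    (π : FinPath S A) : ℝ :=
  ∑ j, w j * M.reachN σ {j} n π

theorem reachN_succ_of_terminal {M : MDP S A} {j : S} (hj : M.terminal j) (σ : Sched S A)
    (n : ℕ) (π : FinPath S A) :
    M.reachN σ {j} (n + 1) π = (if π.last = j then 1 else 0) +
      ∑ a, σ π a * M.backup π.last a (fun s' => M.reachN σ {j} n (π.snoc a s')) := by
  rw [reachN]
  by_cases h : π.last = j
  · have ht : M.terminal π.last := h ▸ hj
    simp [h, hj.backup_eq_zero]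
  · simp [h, backup]

theorem rewardN_zero (M : MDP S A) (σ : Sched S A) (w : S → ℝ) (π : FinPath S A) :
    M.rewardN σ w 0 π = w π.last := by
  simp [rewardN, reachN]

theorem rewardN_succ {M : MDP S A} {w : S → ℝ} (hw : ∀ s, w s ≠ 0 → M.terminal s)
    (σ : Sched S A) (n : ℕ) (π : FinPath S A) :
    M.rewardN σ w (n + 1) π = w π.last +
      ∑ a, σ π a * M.backup π.last a (fun s' => M.rewardN σ w n (π.snoc a s')) := by
  have h : ∀ j, w j * M.reachN σ {j} (n + 1) π = (if π.last = j then w j else 0) +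
      ∑ a, σ π a * M.backup π.last a (fun s' => w j * M.reachN σ {j} n (π.snoc a s')) := by
    intro j
    by_cases hj : w j = 0
    · simp [hj, backup]
    · rw [reachN_succ_of_terminal (hw j hj), mul_add, Finset.mul_sum]
      congr 1
      · simp
      · refine Finset.sum_congr rfl fun a _ => ?_
        rw [backup_const_mul]
        ring
  unfold rewardN
  simp only [h, Finset.sum_add_distrib]
  congr 1
  · simp
  · rw [Finset.sum_comm]
    refine Finset.sum_congr rfl fun a _ => ?_
    simp only [backup, ← Finset.mul_sum]
    rw [Finset.sum_comm]
    simp only [← Finset.mul_sum]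

theorem reachN_nonneg {M : MDP S A} (hM : M.SubProper) {σ : Sched S A} (hσ : M.IsSched σ)
    (T : Set S) (n : ℕ) :
    ∀ π, M.Consistent π → 0 ≤ M.reachN σ T n π := by
  induction n with
  | zero => intro π _; rw [reachN]; split_ifs <;> norm_num
  | succ n ih =>
    intro π hπ
    rw [reachN]
    split_ifs
    · exact zero_le_one
    · exact Finset.sum_nonneg fun a _ => mul_nonneg ((hσ π hπ).1 a)
        (hM.backup_nonneg _ a fun s' h => ih _ (hπ.snoc h))

theorem reachN_le_succ {M : MDP S A} (hM : M.SubProper) {σ : Sched S A} (hσ : M.IsSched σ)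
    (T : Set S) (n : ℕ) :
    ∀ π, M.Consistent π → M.reachN σ T n π ≤ M.reachN σ T (n + 1) π := by
  induction n with
  | zero =>
    intro π hπ
    by_cases h : π.last ∈ T
    · simp [reachN, h]
    · refine le_trans ?_ (reachN_nonneg hM hσ T 1 π hπ)
      simp [reachN, h]
  | succ n ih =>
    intro π hπ
    rw [reachN, reachN]
    split_ifs
    · exact le_rfl
    · exact Finset.sum_le_sum fun a _ => mul_le_mul_of_nonneg_left
        (hM.backup_mono _ a fun s' h => ih _ (hπ.snoc h)) ((hσ π hπ).1 a)

theorem reachN_le_one {M : MDP S A} (hM : M.SubProper) {σ : Sched S A} (hσ : M.IsSched σ)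
    (T : Set S) (n : ℕ) :
    ∀ π, M.Consistent π → M.reachN σ T n π ≤ 1 := by
  induction n with
  | zero => intro π _; rw [reachN]; split_ifs <;> norm_num
  | succ n ih =>
    intro π hπ
    rw [reachN]
    split_ifs
    · exact le_rfl
    · refine le_trans (Finset.sum_le_sum fun a _ => ?_) (hσ.sum_le hπ)
      refine mul_le_of_le_one_right ((hσ π hπ).1 a) ?_
      exact (hM.backup_mono _ a fun s' h => ih _ (hπ.snoc h)).trans
        (hM.backup_const_le _ a zero_le_one)

theorem tendsto_reachN {M : MDP S A} (hM : M.SubProper) {σ : Sched S A} (hσ : M.IsSched σ)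
    (T : Set S) (s : S) :
    Tendsto (fun n => M.reachN σ T n ⟨s, []⟩) atTop (𝓝 (M.Pr σ s T)) := by
  refine tendsto_atTop_ciSup
    (monotone_nat_of_le_succ fun n => reachN_le_succ hM hσ T n _ (M.consistent_nil s)) ⟨1, ?_⟩
  rintro _ ⟨n, rfl⟩
  exact reachN_le_one hM hσ T n _ (M.consistent_nil s)

theorem Pr_singleton_of_terminal {M : MDP S A} {s : S} (hs : M.terminal s) (σ : Sched S A)
    (j : S) : M.Pr σ s {j} = if s = j then 1 else 0 := by
  have h : ∀ n, M.reachN σ {j} n ⟨s, []⟩ = if s = j then 1 else 0 := by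
    intro n
    cases n with
    | zero => simp [reachN]
    | succ n => simp [reachN, hs.prob_eq_zero]
  simp [Pr, h]

/-- The expected `w`-reward upon termination. -/
noncomputable def reward (M : MDP S A) (σ : Sched S A) (w : S → ℝ) (s : S) : ℝ :=
  ∑ j, w j * M.Pr σ s {j}

theorem tendsto_rewardN {M : MDP S A} (hM : M.SubProper) {σ : Sched S A} (hσ : M.IsSched σ)
    (w : S → ℝ) (s : S) :
    Tendsto (fun n => M.rewardN σ w n ⟨s, []⟩) atTop (𝓝 (M.reward σ w s)) :=
  tendsto_finsetSum _ fun _ _ => (tendsto_reachN hM hσ _ s).const_mul _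

theorem reward_of_terminal {M : MDP S A} {s : S} (hs : M.terminal s) (σ : Sched S A)
    (w : S → ℝ) : M.reward σ w s = w s := by
  simp [reward, Pr_singleton_of_terminal hs]

theorem rewardN_nonneg {M : MDP S A} (hM : M.SubProper) {σ : Sched S A} (hσ : M.IsSched σ)
    {w : S → ℝ} (hw : 0 ≤ w) (n : ℕ) {π : FinPath S A} (hπ : M.Consistent π) :
    0 ≤ M.rewardN σ w n π :=
  Finset.sum_nonneg fun j _ => mul_nonneg (hw j) (reachN_nonneg hM hσ _ n π hπ)

theorem rewardN_le_reward {M : MDP S A} (hM : M.SubProper) {σ : Sched S A} (hσ : M.IsSched σ)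
    {w : S → ℝ} (hw : 0 ≤ w) (n : ℕ) (s : S) :
    M.rewardN σ w n ⟨s, []⟩ ≤ M.reward σ w s := by
  have hmono : Monotone fun n => M.rewardN σ w n ⟨s, []⟩ :=
    monotone_nat_of_le_succ fun n => Finset.sum_le_sum fun j _ =>
      mul_le_mul_of_nonneg_left (reachN_le_succ hM hσ _ n _ (M.consistent_nil s)) (hw j)
  exact hmono.ge_of_tendsto (tendsto_rewardN hM hσ w s) n

/-- `g` is a super-solution of the `γ`-discounted Bellman equation with terminal reward `w`. -/
def IsExcessive (M : MDP S A) (γ : ℝ) (w g : S → ℝ) : Prop :=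
  ∀ s, w s ≤ g s ∧ ∀ a, w s + γ * M.backup s a g ≤ g s

theorem IsExcessive.pow_mul_rewardN_le {M : MDP S A} (hM : M.SubProper) {γ : ℝ} (hγ : 0 ≤ γ)
    (hγ' : γ ≤ 1) {w g : S → ℝ} (hw : 0 ≤ w) (hwt : ∀ s, w s ≠ 0 → M.terminal s)
    (hg : M.IsExcessive γ w g) {σ : Sched S A} (hσ : M.IsSched σ) (n : ℕ) :
    ∀ π, M.Consistent π → γ ^ n * M.rewardN σ w n π ≤ g π.last := by
  induction n with
  | zero => intro π _; simpa [rewardN_zero] using (hg π.last).1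
  | succ n ih =>
    intro π hπ
    rw [rewardN_succ hwt, mul_add, Finset.mul_sum]
    calc γ ^ (n + 1) * w π.last + ∑ a, γ ^ (n + 1) *
            (σ π a * M.backup π.last a fun s' => M.rewardN σ w n (π.snoc a s'))
        ≤ w π.last + ∑ a, σ π a * (g π.last - w π.last) := by
          refine add_le_add (mul_le_of_le_one_left (hw _) (pow_le_one₀ hγ hγ'))
            (Finset.sum_le_sum fun a _ => ?_)
          have h1 : γ ^ n * M.backup π.last a (fun s' => M.rewardN σ w n (π.snoc a s'))
              ≤ M.backup π.last a g := by
            rw [← backup_const_mul]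
            refine hM.backup_mono _ a fun s' h => ?_
            simpa using ih _ (hπ.snoc h)
          have h2 := (hg π.last).2 a
          have h3 := mul_le_mul_of_nonneg_left h1 hγ
          have h4 := (hσ π hπ).1 a
          calc _ = σ π a * (γ * (γ ^ n *
                M.backup π.last a (fun s' => M.rewardN σ w n (π.snoc a s')))) := by ring
            _ ≤ _ := mul_le_mul_of_nonneg_left (by linarith) h4
      _ ≤ w π.last + 1 * (g π.last - w π.last) := by
          rw [← Finset.sum_mul]
          gcongr
          · exact sub_nonneg.2 (hg _).1
          · exact hσ.sum_le hπ
      _ = g π.last := by ring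

theorem IsExcessive.reward_le {M : MDP S A} (hM : M.SubProper) {w g : S → ℝ} (hw : 0 ≤ w)
    (hwt : ∀ s, w s ≠ 0 → M.terminal s) (hg : M.IsExcessive 1 w g) {σ : Sched S A}
    (hσ : M.IsSched σ) (s : S) : M.reward σ w s ≤ g s :=
  le_of_tendsto' (tendsto_rewardN hM hσ w s) fun n => by
    simpa using hg.pow_mul_rewardN_le hM zero_le_one le_rfl hw hwt hσ n _ (M.consistent_nil s)

/-- The best expected value of `g` after one step (or zero, when stopping). -/
noncomputable def best (M : MDP S A) (s : S) (g : S → ℝ) : ℝ :=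
  Finset.univ.sup' Finset.univ_nonempty fun o : Option A => o.elim 0 fun a => M.backup s a g

theorem best_nonneg (M : MDP S A) (s : S) (g : S → ℝ) : 0 ≤ M.best s g :=
  Finset.le_sup' (fun o : Option A => o.elim 0 fun a => M.backup s a g) (Finset.mem_univ none)

theorem backup_le_best (M : MDP S A) (s : S) (a : A) (g : S → ℝ) : M.backup s a g ≤ M.best s g :=
  Finset.le_sup' (fun o : Option A => o.elim 0 fun a => M.backup s a g) (Finset.mem_univ (some a))

theorem SubProper.best_le_add_dist {M : MDP S A} (hM : M.SubProper) (s : S) (g g' : S → ℝ) :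
    M.best s g ≤ M.best s g' + dist g g' := by
  refine Finset.sup'_le _ _ fun o _ => ?_
  cases o with
  | none => exact add_nonneg (M.best_nonneg s g') dist_nonneg
  | some a =>
    calc M.backup s a g ≤ M.backup s a (fun s' => g' s' + dist g g') :=
          hM.backup_mono s a fun s' _ => by
            have := (le_abs_self (g s' - g' s')).trans (dist_le_pi_dist g g' s')
            linarith
      _ = M.backup s a g' + M.backup s a (fun _ => dist g g') := M.backup_add s a _ _
      _ ≤ _ := add_le_add (M.backup_le_best s a g') (hM.backup_const_le s a dist_nonneg)

theorem exists_selector_best {M : MDP S A} (hM : M.SubProper) {g : S → ℝ} (hg : 0 ≤ g) :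
    ∃ δ, M.IsSelector δ ∧ ∀ s, M.best s g = (δ s).elim 0 fun a => M.backup s a g := by
  have h : ∀ s, ∃ o : Option A, ((∀ a, o = some a → M.enabled s a) ∧
      (¬M.terminal s → o ≠ none)) ∧ M.best s g = o.elim 0 fun a => M.backup s a g := by
    intro s
    obtain ⟨o, -, ho⟩ := Finset.exists_mem_eq_sup' (Finset.univ_nonempty (α := Option A))
      fun o : Option A => o.elim 0 fun a => M.backup s a g
    replace ho : M.best s g = o.elim 0 fun a => M.backup s a g := ho
    by_cases hopt : ∃ a, o = some a ∧ M.enabled s a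
    · obtain ⟨a, rfl, ha⟩ := hopt
      exact ⟨some a, ⟨by rintro b ⟨⟩; exact ha, by simp⟩, ho⟩
    · have h0 : M.best s g = 0 := by
        rw [ho]
        cases o with
        | none => rfl
        | some a => exact backup_eq_zero_of_not_enabled (fun h => hopt ⟨a, rfl, h⟩) g
      by_cases ht : M.terminal s
      · exact ⟨none, ⟨by simp, fun h => absurd ht h⟩, h0⟩
      · obtain ⟨a, ha⟩ := not_forall.1 ht
        refine ⟨some a, ⟨by rintro b ⟨⟩; exact ha, by simp⟩, ?_⟩
        exact le_antisymm (h0.trans_le (hM.backup_nonneg s a fun s' _ => hg s'))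
          (M.backup_le_best s a g)
  choose δ h1 h2 using h
  exact ⟨δ, h1, h2⟩

theorem exists_discounted_value {M : MDP S A} (hM : M.SubProper) {γ : ℝ} (hγ : 0 ≤ γ)
    (hγ' : γ < 1) (w : S → ℝ) : ∃ V : S → ℝ, ∀ s, V s = w s + γ * M.best s V := by
  have hc : ContractingWith ⟨γ, hγ⟩ fun (V : S → ℝ) s => w s + γ * M.best s V := by
    refine ⟨by exact_mod_cast hγ', LipschitzWith.of_dist_le_mul fun V V' => ?_⟩
    refine (dist_pi_le_iff (by positivity)).2 fun s => ?_
    rw [Real.dist_eq]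
    have h1 := hM.best_le_add_dist s V V'
    have h2 := hM.best_le_add_dist s V' V
    rw [dist_comm] at h2
    rw [add_sub_add_left_eq_sub, ← mul_sub, abs_mul, abs_of_nonneg hγ]
    exact mul_le_mul_of_nonneg_left (abs_le.2 ⟨by linarith, by linarith⟩) hγ
  exact ⟨ContractingWith.fixedPoint _ hc, fun s => (congrFun hc.fixedPoint_isFixedPt s).symm⟩

/-- A greedy deterministic memoryless scheduler earns at least the discounted value. -/
theorem discounted_value_le_reward {M : MDP S A} (hM : M.SubProper) {γ : ℝ} (hγ : 0 ≤ γ)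
    (hγ' : γ < 1) {w V : S → ℝ} (hw : 0 ≤ w) (hwt : ∀ s, w s ≠ 0 → M.terminal s)
    {δ : S → Option A} (hδ : M.IsSelector δ)
    (hV : ∀ s, V s = w s + γ * (δ s).elim 0 fun a => M.backup s a V) (s : S) :
    V s ≤ M.reward (selSched δ) w s := by
  have key : ∀ n π, M.Consistent π →
      V π.last ≤ M.rewardN (selSched δ) w n π + γ ^ n * ∑ s, |V s| := by
    intro n
    induction n with
    | zero =>
      intro π _
      have h1 := Finset.single_le_sum (f := fun s => |V s|) (fun s _ => abs_nonneg (V s))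
        (Finset.mem_univ π.last)
      have h2 := le_abs_self (V π.last)
      have h3 := hw π.last
      simp only [Pi.zero_apply] at h3
      rw [rewardN_zero]
      linarith
    | succ n ih =>
      intro π hπ
      rw [rewardN_succ hwt, sum_selSched_mul, hV π.last, add_assoc]
      gcongr
      cases δ π.last with
      | none => simp only [Option.elim_none, mul_zero, zero_add]; positivity
      | some a =>
        simp only [Option.elim_some]
        set R := M.backup π.last a
            (fun s' => M.rewardN (selSched δ) w n (π.snoc a s')) with hRdef
        have hR : 0 ≤ R :=
          hM.backup_nonneg _ a fun s' h => rewardN_nonneg hM hδ.isSched hw n (hπ.snoc h)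
        have h1 : M.backup π.last a V ≤ R + γ ^ n * ∑ s, |V s| :=
          calc M.backup π.last a V
              ≤ M.backup π.last a (fun s' => M.rewardN (selSched δ) w n (π.snoc a s') +
                  γ ^ n * ∑ s, |V s|) :=
                hM.backup_mono _ a fun s' h => by simpa using ih _ (hπ.snoc h)
            _ = _ := M.backup_add _ a _ _
            _ ≤ _ := by
                gcongr
                exact hM.backup_const_le _ a (by positivity)
        calc γ * M.backup π.last a V ≤ γ * (R + γ ^ n * ∑ s, |V s|) :=
              mul_le_mul_of_nonneg_left h1 hγ
          _ = γ * R + γ ^ (n + 1) * ∑ s, |V s| := by ring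
          _ ≤ _ := by
              gcongr
              exact mul_le_of_le_one_left hR hγ'.le
  have hlim : Tendsto (fun n => M.rewardN (selSched δ) w n ⟨s, []⟩ + γ ^ n * ∑ s, |V s|) atTop
      (𝓝 (M.reward (selSched δ) w s + 0 * ∑ s, |V s|)) :=
    (tendsto_rewardN hM hδ.isSched w s).add
      ((tendsto_pow_atTop_nhds_zero_of_lt_one hγ hγ').mul_const _)
  simpa using ge_of_tendsto' hlim fun n => key n _ (M.consistent_nil s)

/-- Some deterministic memoryless scheduler is optimal for the terminal reward `w`. -/
theorem exists_optimal_selector {M : MDP S A} (hM : M.SubProper) {w : S → ℝ} (hw : 0 ≤ w)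
    (hwt : ∀ s, w s ≠ 0 → M.terminal s) :
    ∃ δ, M.IsSelector δ ∧ M.IsExcessive 1 w (M.reward (selSched δ) w) := by
  have hu : ∀ m : ℕ, (0 : ℝ) ≤ 1 - 1 / ((m : ℝ) + 1) ∧ 1 - 1 / ((m : ℝ) + 1) < 1 := by
    intro m
    have h1 : 1 / ((m : ℝ) + 1) ≤ 1 := by
      rw [div_le_one (by positivity)]
      linarith [(Nat.cast_nonneg m : (0 : ℝ) ≤ m)]
    have h2 : 0 < 1 / ((m : ℝ) + 1) := by positivity
    constructor <;> linarith
  have hex : ∀ m : ℕ, ∃ (V : S → ℝ) (δ : S → Option A), 0 ≤ V ∧ M.IsSelector δ ∧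
      (∀ s, V s = w s + (1 - 1 / ((m : ℝ) + 1)) * M.best s V) ∧
      ∀ s, M.best s V = (δ s).elim 0 fun a => M.backup s a V := by
    intro m
    obtain ⟨V, hV⟩ := exists_discounted_value hM (hu m).1 (hu m).2 w
    have hV0 : 0 ≤ V := fun s => by
      rw [hV s]
      exact add_nonneg (hw s) (mul_nonneg (hu m).1 (M.best_nonneg s V))
    obtain ⟨δ, h1, h2⟩ := exists_selector_best hM hV0
    exact ⟨V, δ, hV0, h1, hV, h2⟩
  choose V δ hV0 hδ hV hbest using hex
  obtain ⟨δ₀, hδ₀⟩ := Finite.exists_infinite_fiber δ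
  have hfreq : ∃ᶠ m in atTop, δ m = δ₀ :=
    Nat.frequently_atTop_iff_infinite.2 (Set.infinite_coe_iff.1 hδ₀)
  obtain ⟨m₀, hm₀⟩ := hfreq.exists
  have hsel : M.IsSelector δ₀ := hm₀ ▸ hδ m₀
  refine ⟨δ₀, hsel, fun s => ⟨?_, fun a => ?_⟩⟩
  · simpa [rewardN_zero] using rewardN_le_reward hM hsel.isSched hw 0 s
  have hn : ∀ n, w s + 1 * M.backup s a (fun s' => M.rewardN (selSched δ₀) w n ⟨s', []⟩) ≤
      M.reward (selSched δ₀) w s := by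
    intro n
    set R := M.backup s a (fun s' => M.rewardN (selSched δ₀) w n ⟨s', []⟩) with hR
    have hlim : Tendsto (fun m : ℕ => w s + (1 - 1 / ((m : ℝ) + 1)) ^ (n + 1) * R) atTop
        (𝓝 (w s + (1 - 0) ^ (n + 1) * R)) :=
      (((tendsto_one_div_add_atTop_nhds_zero_nat.const_sub 1).pow (n + 1)).mul_const R).const_add _
    rw [sub_zero, one_pow] at hlim
    refine le_of_tendsto_of_frequently hlim (hfreq.mono fun m hm => ?_)
    have hexc : M.IsExcessive (1 - 1 / ((m : ℝ) + 1)) w (V m) := fun t => by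
      rw [hV m t]
      refine ⟨le_add_of_nonneg_right (mul_nonneg (hu m).1 (M.best_nonneg t _)), fun b => ?_⟩
      gcongr
      · exact (hu m).1
      · exact M.backup_le_best t b _
    have hle : (1 - 1 / ((m : ℝ) + 1)) ^ n * R ≤ M.backup s a (V m) := by
      rw [hR, ← backup_const_mul]
      exact hM.backup_mono s a fun s' _ => hexc.pow_mul_rewardN_le hM (hu m).1 (hu m).2.le hw hwt
        hsel.isSched n _ (M.consistent_nil s')
    calc w s + (1 - 1 / ((m : ℝ) + 1)) ^ (n + 1) * R
        = w s + (1 - 1 / ((m : ℝ) + 1)) * ((1 - 1 / ((m : ℝ) + 1)) ^ n * R) := by ring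
      _ ≤ w s + (1 - 1 / ((m : ℝ) + 1)) * M.backup s a (V m) := by
          gcongr
          exact (hu m).1
      _ ≤ V m s := (hexc s).2 a
      _ ≤ _ := discounted_value_le_reward hM (hu m).1 (hu m).2 hw hwt hsel
          (fun t => by rw [← hm, ← hbest m t]; exact hV m t) s
  have hlim : Tendsto (fun n => M.backup s a fun s' => M.rewardN (selSched δ₀) w n ⟨s', []⟩) atTop
      (𝓝 (M.backup s a (M.reward (selSched δ₀) w))) :=
    tendsto_finsetSum _ fun s' _ => (tendsto_rewardN hM hsel.isSched w s').const_mul _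
  exact le_of_tendsto' ((hlim.const_mul 1).const_add _) hn

end MDP

end SD

namespace SD

open Filter Topology

namespace MDP

variable {S A : Type}

/-- The product of the scheduler's choices along the continuation `l` of the history `π`. -/
def pathWeight (σ : Sched S A) : FinPath S A → List (A × S) → ℝ
  | _, [] => 1
  | π, (a, s) :: l => σ π a * pathWeight σ (π.snoc a s) l

theorem pathWeight_append (σ : Sched S A) (a : A) (s : S) (l : List (A × S)) :
    ∀ π : FinPath S A, pathWeight σ π (l ++ [(a, s)]) =
      pathWeight σ π l * σ ⟨π.start, π.steps ++ l⟩ a := by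
  induction l with
  | nil => intro π; simp [pathWeight]
  | cons x l ih =>
    intro π
    simp [pathWeight, ih, FinPath.snoc, mul_assoc]

/-- The product of the scheduler's choices along a finite path. -/
def weight (σ : Sched S A) (π : FinPath S A) : ℝ := pathWeight σ ⟨π.start, []⟩ π.steps

theorem weight_snoc (σ : Sched S A) (π : FinPath S A) (a : A) (s : S) :
    weight σ (π.snoc a s) = weight σ π * σ π a := by
  simp [weight, FinPath.snoc, pathWeight_append]

theorem IsSched.pathWeight_nonneg [Fintype A] {M : MDP S A} {σ : Sched S A} (hσ : M.IsSched σ)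
    (l : List (A × S)) :
    ∀ π, M.Consistent π → M.ConsistentFrom π.last l → 0 ≤ pathWeight σ π l := by
  induction l with
  | nil => intro π _ _; exact zero_le_one
  | cons x l ih =>
    intro π hπ hl
    exact mul_nonneg ((hσ π hπ).1 _) (ih _ (hπ.snoc hl.1) (by simpa using hl.2))

theorem IsSched.weight_nonneg [Fintype A] {M : MDP S A} {σ : Sched S A} (hσ : M.IsSched σ)
    {π : FinPath S A} (hπ : M.Consistent π) : 0 ≤ weight σ π :=
  hσ.pathWeight_nonneg _ _ (M.consistent_nil _) hπ

/-- The scheduler that tosses an `x : y`-biased coin at the beginning and then follows `σ` or `τ`,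
in behavioural form. -/
noncomputable def mix (σ τ : Sched S A) (x y : ℝ) : Sched S A := fun π a =>
  if x * weight σ π + y * weight τ π = 0 then σ π a
  else (x * weight σ π * σ π a + y * weight τ π * τ π a) / (x * weight σ π + y * weight τ π)

theorem mul_mix {σ τ : Sched S A} {x y : ℝ} {π : FinPath S A} (hσ : 0 ≤ x * weight σ π)
    (hτ : 0 ≤ y * weight τ π) (a : A) :
    (x * weight σ π + y * weight τ π) * mix σ τ x y π a =
      x * weight σ π * σ π a + y * weight τ π * τ π a := by
  unfold mix
  split_ifs with h
  · obtain ⟨h1, h2⟩ := (add_eq_zero_iff_of_nonneg hσ hτ).1 h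
    simp [h1, h2]
  · rw [mul_div_cancel₀ _ h]

theorem IsSched.mix [Fintype A] {M : MDP S A} {σ τ : Sched S A} (hσ : M.IsSched σ)
    (hτ : M.IsSched τ) {x y : ℝ} (hx : 0 ≤ x) (hy : 0 ≤ y) : M.IsSched (mix σ τ x y) := by
  intro π hπ
  have h1 := mul_nonneg hx (hσ.weight_nonneg hπ)
  have h2 := mul_nonneg hy (hτ.weight_nonneg hπ)
  by_cases h : x * weight σ π + y * weight τ π = 0
  · simpa [MDP.mix, h] using hσ π hπ
  · simp only [MDP.mix, h, if_false]
    refine ⟨fun a => ?_, fun a ha => ?_, fun ht => ?_⟩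
    · exact div_nonneg (add_nonneg (mul_nonneg h1 ((hσ π hπ).1 a))
        (mul_nonneg h2 ((hτ π hπ).1 a))) (add_nonneg h1 h2)
    · by_contra hen
      have e1 : σ π a = 0 := by_contra fun h => hen ((hσ π hπ).2.1 a h)
      have e2 : τ π a = 0 := by_contra fun h => hen ((hτ π hπ).2.1 a h)
      simp [e1, e2] at ha
    · rw [← Finset.sum_div, Finset.sum_add_distrib, ← Finset.mul_sum, ← Finset.mul_sum,
        (hσ π hπ).2.2 ht, (hτ π hπ).2.2 ht, mul_one, mul_one, div_self h]

theorem reachN_mix [Fintype S] [Fintype A] {M : MDP S A} {σ τ : Sched S A} (hσ : M.IsSched σ)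
    (hτ : M.IsSched τ) {x y : ℝ} (hx : 0 ≤ x) (hy : 0 ≤ y) (T : Set S) (n : ℕ) :
    ∀ π, M.Consistent π →
      (x * weight σ π + y * weight τ π) * M.reachN (mix σ τ x y) T n π =
        x * weight σ π * M.reachN σ T n π + y * weight τ π * M.reachN τ T n π := by
  induction n with
  | zero => intro π _; simp only [reachN]; ring
  | succ n ih =>
    intro π hπ
    simp only [reachN]
    split_ifs with h
    · ring
    · simp only [Finset.mul_sum]
      rw [← Finset.sum_add_distrib]
      refine Finset.sum_congr rfl fun a _ => ?_
      rw [← Finset.sum_add_distrib]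
      refine Finset.sum_congr rfl fun s' _ => ?_
      by_cases h0 : M.prob π.last a s' = 0
      · simp [h0]
      · have h1 := ih _ (hπ.snoc h0)
        have h2 := mul_mix (mul_nonneg hx (hσ.weight_nonneg hπ))
          (mul_nonneg hy (hτ.weight_nonneg hπ)) a
        rw [weight_snoc, weight_snoc, ← mul_assoc, ← mul_assoc, ← h2] at h1
        linear_combination M.prob π.last a s' * h1

theorem Pr_mix [Fintype S] [Fintype A] {M : MDP S A} (hM : M.SubProper) {σ τ : Sched S A}
    (hσ : M.IsSched σ) (hτ : M.IsSched τ) {x y : ℝ} (hx : 0 ≤ x) (hy : 0 ≤ y) (hxy : x + y = 1)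
    (s : S) (T : Set S) : M.Pr (mix σ τ x y) s T = x * M.Pr σ s T + y * M.Pr τ s T := by
  refine tendsto_nhds_unique (tendsto_reachN hM (hσ.mix hτ hx hy) T s) ?_
  refine (((tendsto_reachN hM hσ T s).const_mul x).add
    ((tendsto_reachN hM hτ T s).const_mul y)).congr fun n => ?_
  have h := reachN_mix hσ hτ hx hy T n _ (M.consistent_nil s)
  simpa [weight, pathWeight, hxy] using h.symm

end MDP

namespace OMDP

variable {S A : Type} [Fintype S]

/-- Well-formedness, with terminal states besides the exits allowed. -/
structure PreWF (𝒜 : OMDP S A) : Prop where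
  subProper : 𝒜.M.SubProper
  terminal_of_mem_exit : ∀ s ∈ 𝒜.exit, 𝒜.M.terminal s
  nodup : (𝒜.Ir ++ 𝒜.Il ++ 𝒜.Or ++ 𝒜.Ol).Nodup

theorem WF.preWF {𝒜 : OMDP S A} (h : 𝒜.WF) : 𝒜.PreWF :=
  ⟨h.1.subProper, fun s hs => (h.2.2 s).1 hs, h.2.1⟩

theorem PreWF.nodup_Or {𝒜 : OMDP S A} (h : 𝒜.PreWF) : 𝒜.Or.Nodup := by
  have := h.nodup
  simp only [List.nodup_append] at this
  exact this.1.2.1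

theorem PreWF.nodup_Ol {𝒜 : OMDP S A} (h : 𝒜.PreWF) : 𝒜.Ol.Nodup := by
  have := h.nodup
  simp only [List.nodup_append] at this
  exact this.2.1

theorem PreWF.disjoint_Or_Ol {𝒜 : OMDP S A} (h : 𝒜.PreWF) {s : S} (hr : s ∈ 𝒜.Or)
    (hl : s ∈ 𝒜.Ol) : False := by
  have := h.nodup
  simp only [List.nodup_append] at this
  exact this.2.2 s (by simp [hr]) s hl rfl

theorem PreWF.not_mem_exit_of_mem_entr {𝒜 : OMDP S A} (h : 𝒜.PreWF) {s : S}
    (hs : s ∈ 𝒜.entr) : s ∉ 𝒜.exit := by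
  have := h.nodup
  rw [List.append_assoc, List.nodup_append] at this
  exact fun he => this.2.2 s hs s he rfl

variable [Fintype A]

theorem convex_achievable {𝒜 : OMDP S A} (hM : 𝒜.M.SubProper) (i : S) :
    Convex ℝ (𝒜.achievable i) := by
  rintro p ⟨σ, hσ, hp⟩ q ⟨τ, hτ, hq⟩ x y hx hy hxy
  refine ⟨MDP.mix σ τ x y, hσ.mix hτ hx hy, fun j => ?_⟩
  rw [prVec, MDP.Pr_mix hM hσ hτ hx hy hxy]
  exact add_le_add (mul_le_mul_of_nonneg_left (hp j) hx) (mul_le_mul_of_nonneg_left (hq j) hy)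

theorem reward_eq_sum_prVec (𝒜 : OMDP S A) (σ : Sched S A) {w : S → ℝ}
    (hw : ∀ s, s ∉ 𝒜.exit → w s = 0) (s : S) :
    𝒜.M.reward σ w s = ∑ j : 𝒜.ExitIdx, w j.1 * 𝒜.prVec σ s j := by
  rw [MDP.reward, ← Fintype.sum_subtype_add_sum_subtype (· ∈ 𝒜.exit)]
  rw [Finset.sum_eq_zero (s := (Finset.univ : Finset {s // s ∉ 𝒜.exit})), add_zero]
  · simp only [prVec]
    congr!
  · intro j _
    rw [hw _ j.2, zero_mul]

/-- The achievable sets are determined by the excessive functions. -/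
theorem mem_achievable_iff {𝒜 : OMDP S A} (hM : 𝒜.M.SubProper)
    (hT : ∀ s ∈ 𝒜.exit, 𝒜.M.terminal s) (i : S) (p : 𝒜.ExitIdx → ℝ) :
    p ∈ 𝒜.achievable i ↔ ∀ w g : S → ℝ, 0 ≤ w → (∀ s, s ∉ 𝒜.exit → w s = 0) →
      𝒜.M.IsExcessive 1 w g → ∑ j : 𝒜.ExitIdx, w j.1 * p j ≤ g i := by
  have hwt : ∀ w : S → ℝ, (∀ s, s ∉ 𝒜.exit → w s = 0) → ∀ s, w s ≠ 0 → 𝒜.M.terminal s :=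
    fun w hw s hs => hT s (by_contra fun h => hs (hw s h))
  constructor
  · rintro ⟨σ, hσ, hp⟩ w g hw0 hw hg
    calc ∑ j : 𝒜.ExitIdx, w j.1 * p j ≤ ∑ j : 𝒜.ExitIdx, w j.1 * 𝒜.prVec σ i j :=
          Finset.sum_le_sum fun j _ => mul_le_mul_of_nonneg_left (hp j) (hw0 _)
      _ = 𝒜.M.reward σ w i := (𝒜.reward_eq_sum_prVec σ hw i).symm
      _ ≤ g i := hg.reward_le hM hw0 (hwt w hw) hσ i
  · intro h
    set F : Set (𝒜.ExitIdx → ℝ) :=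
      (fun δ => 𝒜.prVec (MDP.selSched δ) i) '' {δ | 𝒜.M.IsSelector δ} with hF
    have hFA : convexHull ℝ F ⊆ 𝒜.achievable i := by
      refine convexHull_min ?_ (convex_achievable hM i)
      rintro _ ⟨δ, hδ, rfl⟩
      exact ⟨_, MDP.IsSelector.isSched hδ, le_rfl⟩
    by_cases hdis : Disjoint (convexHull ℝ F) (Set.Ici p)
    · exfalso
      obtain ⟨f, u, v, hfu, huv, hvf⟩ := geometric_hahn_banach_compact_closed
        (convex_convexHull ℝ F) ((Set.toFinite F).isCompact_convexHull ℝ)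
        (convex_Ici p) isClosed_Ici hdis
      have hfsum : ∀ q : 𝒜.ExitIdx → ℝ, f q = ∑ j, f (Pi.single j 1) * q j := by
        intro q
        conv_lhs => rw [pi_eq_sum_univ' q]
        simp [map_sum, mul_comm, Pi.single]
      have hfpos : ∀ j, 0 ≤ f (Pi.single j 1) := by
        intro j
        by_contra! hneg
        have hj0 : (0 : 𝒜.ExitIdx → ℝ) ≤ Pi.single j 1 := Pi.single_nonneg.2 zero_le_one
        have hp := hvf p Set.self_mem_Ici
        have ht : 0 ≤ (v - f p) / f (Pi.single j 1) :=
          div_nonneg_of_nonpos (by linarith) hneg.le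
        have h1 := hvf (p + ((v - f p) / f (Pi.single j 1)) • Pi.single j 1)
          (le_add_of_nonneg_right (smul_nonneg ht hj0))
        rw [map_add, map_smul, smul_eq_mul, div_mul_cancel₀ _ hneg.ne] at h1
        linarith
      let w : S → ℝ := fun s => if hs : s ∈ 𝒜.exit then f (Pi.single ⟨s, hs⟩ 1) else 0
      have hw0 : 0 ≤ w := fun s => by
        by_cases hs : s ∈ 𝒜.exit
        · simpa [w, hs] using hfpos ⟨s, hs⟩
        · simp [w, hs]
      have hw : ∀ s, s ∉ 𝒜.exit → w s = 0 := fun s hs => by simp [w, hs]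
      have hwf : ∀ q : 𝒜.ExitIdx → ℝ, ∑ j : 𝒜.ExitIdx, w j.1 * q j = f q := fun q => by
        rw [hfsum q]
        exact Finset.sum_congr rfl fun j _ => by simp only [w, dif_pos j.2]
      obtain ⟨δ, hδ, hexc⟩ := MDP.exists_optimal_selector hM hw0 (hwt w hw)
      have h1 := h w _ hw0 hw hexc
      rw [reward_eq_sum_prVec _ _ hw, hwf, hwf] at h1
      have h2 := hfu _ (subset_convexHull ℝ F ⟨δ, hδ, rfl⟩)
      have h3 := hvf p Set.self_mem_Ici
      linarith
    · obtain ⟨q, hq, hpq⟩ := Set.not_disjoint_iff.1 hdis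
      obtain ⟨σ, hσ, hqσ⟩ := hFA hq
      exact ⟨σ, hσ, le_trans hpq hqσ⟩

/-- An optimal value function for the exit rewards `u` is bounded at the entrances by any bound
valid for the generating points. -/
theorem exists_isExcessive_le {𝒜 : OMDP S A} (h𝒜 : 𝒜.PreWF)
    {V : 𝒜.EntrIdx → Finset (𝒜.ExitIdx → ℝ)}
    (hgen : ∀ k : 𝒜.EntrIdx,
      𝒜.achievable k.1 = dwConv ((V k : Finset (𝒜.ExitIdx → ℝ)) : Set (𝒜.ExitIdx → ℝ)))
    {u c : S → ℝ} (hu0 : 0 ≤ u) (hu : ∀ s, s ∉ 𝒜.exit → u s = 0)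
    (hc : ∀ k, ∀ q ∈ V k, ∑ j, q j * u j.1 ≤ c k.1) :
    ∃ f, 𝒜.M.IsExcessive 1 u f ∧ (∀ s ∈ 𝒜.exit, f s = u s) ∧ ∀ k ∈ 𝒜.entr, f k ≤ c k := by
  obtain ⟨δ, hδ, hexc⟩ := MDP.exists_optimal_selector h𝒜.subProper hu0
    fun s hs => h𝒜.terminal_of_mem_exit s (by_contra fun h => hs (hu s h))
  refine ⟨_, hexc, fun s hs => MDP.reward_of_terminal (h𝒜.terminal_of_mem_exit s hs) _ _,
    fun k hk => ?_⟩
  rw [reward_eq_sum_prVec _ _ hu]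
  have hmem : 𝒜.prVec (MDP.selSched δ) k ∈ 𝒜.achievable k := ⟨_, hδ.isSched, le_rfl⟩
  rw [hgen ⟨k, hk⟩] at hmem
  obtain ⟨q, hq, hle⟩ := hmem
  have hconv : Convex ℝ {q : 𝒜.ExitIdx → ℝ | ∑ j, q j * u j.1 ≤ c k} := by
    intro q hq q' hq' x y hx hy hxy
    simp only [Set.mem_ofPred_eq] at hq hq' ⊢
    calc ∑ j, (x • q + y • q') j * u j.1 = x * ∑ j, q j * u j.1 + y * ∑ j, q' j * u j.1 := by
          rw [Finset.mul_sum, Finset.mul_sum, ← Finset.sum_add_distrib]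
          exact Finset.sum_congr rfl fun j _ => by simp; ring
      _ ≤ x * c k + y * c k := by gcongr
      _ = c k := by rw [← add_mul, hxy, one_mul]
  calc ∑ j : 𝒜.ExitIdx, u j.1 * 𝒜.prVec (MDP.selSched δ) k j ≤ ∑ j, q j * u j.1 :=
        Finset.sum_le_sum fun j _ => by
          rw [mul_comm]
          exact mul_le_mul_of_nonneg_right (hle j) (hu0 _)
    _ ≤ c k := convexHull_min (hc ⟨k, hk⟩) hconv hq

/-- A function that is excessive outside of the exits dominates at the entrances its averages under
the generating points. -/
theorem sum_mul_le_of_backup_le {𝒜 : OMDP S A} (h𝒜 : 𝒜.PreWF)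
    {V : 𝒜.EntrIdx → Finset (𝒜.ExitIdx → ℝ)}
    (hgen : ∀ k : 𝒜.EntrIdx,
      𝒜.achievable k.1 = dwConv ((V k : Finset (𝒜.ExitIdx → ℝ)) : Set (𝒜.ExitIdx → ℝ)))
    {g : S → ℝ} (hg0 : 0 ≤ g) (hg : ∀ s, s ∉ 𝒜.exit → ∀ a, 𝒜.M.backup s a g ≤ g s)
    {k : 𝒜.EntrIdx} {q : 𝒜.ExitIdx → ℝ} (hq : q ∈ V k) : ∑ j, q j * g j.1 ≤ g k.1 := by
  have hmem : q ∈ 𝒜.achievable k.1 := by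
    rw [hgen k]
    exact ⟨q, subset_convexHull ℝ _ hq, le_rfl⟩
  have h := (mem_achievable_iff h𝒜.subProper h𝒜.terminal_of_mem_exit k.1 q).1 hmem
    (fun s => if s ∈ 𝒜.exit then g s else 0) g
    (fun s => by dsimp only; split_ifs; exacts [hg0 s, le_rfl])
    (fun s hs => if_neg hs) (fun s => by
      by_cases hs : s ∈ 𝒜.exit
      · simp [hs, (h𝒜.terminal_of_mem_exit s hs).backup_eq_zero]
      · simpa [hs] using ⟨hg0 s, hg s hs⟩)
  refine le_trans (Finset.sum_le_sum fun j _ => ?_) h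
  simp [j.2, mul_comm]

end OMDP

end SD

namespace SD

namespace OMDP

section Shortcut

theorem shortcut_terminal_of_not_mem_entr {S A : Type} (𝒜 : OMDP S A)
    (B : 𝒜.EntrIdx → Finset (𝒜.ExitIdx → ℝ)) {s : S} (h : s ∉ 𝒜.entr) :
    (𝒜.shortcut B).M.terminal (some s) := by
  intro q
  exact dif_neg fun ⟨hs, _⟩ => h hs

variable {S A : Type} [Fintype S]

theorem shortcut_backup_of_mem (𝒜 : OMDP S A) {B : 𝒜.EntrIdx → Finset (𝒜.ExitIdx → ℝ)} {s : S}
    {q : 𝒜.ShortAct B} (h : ∃ hs : s ∈ 𝒜.entr, q.1 ∈ B ⟨s, hs⟩) (g : Option S → ℝ) :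
    (𝒜.shortcut B).M.backup (some s) q g =
      (1 - ∑ j, q.1 j) * g none + ∑ j, q.1 j * g (some j.1) := by
  have h1 : ∀ s', (𝒜.shortcut B).M.prob (some s) q (some s') =
      ∑ j : 𝒜.ExitIdx, if j.1 = s' then q.1 j else 0 := fun s' => by
    simp only [MDP.prob, shortcut, dif_pos h, Option.elim_some]
  have h2 : (𝒜.shortcut B).M.prob (some s) q none = 1 - ∑ j, q.1 j := by
    simp only [MDP.prob, shortcut, dif_pos h, Option.elim_some]
  rw [MDP.backup, Fintype.sum_option, h2]
  congr 1
  simp only [h1, Finset.sum_mul]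
  rw [Finset.sum_comm]
  refine Finset.sum_congr rfl fun j _ => ?_
  simp

theorem shortcut_backup_of_not_mem (𝒜 : OMDP S A) {B : 𝒜.EntrIdx → Finset (𝒜.ExitIdx → ℝ)} {s : S}
    {q : 𝒜.ShortAct B} (h : ¬∃ hs : s ∈ 𝒜.entr, q.1 ∈ B ⟨s, hs⟩) (g : Option S → ℝ) :
    (𝒜.shortcut B).M.backup (some s) q g = 0 := by
  have hP : (𝒜.shortcut B).M.P (some s) q = none := dif_neg h
  simp [MDP.backup, MDP.prob, hP]

theorem shortcut_backup_none (𝒜 : OMDP S A) {B : 𝒜.EntrIdx → Finset (𝒜.ExitIdx → ℝ)}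
    (q : 𝒜.ShortAct B) (g : Option S → ℝ) : (𝒜.shortcut B).M.backup none q g = 0 := by
  simp [MDP.backup, MDP.prob, shortcut]

theorem shortcut_subProper (𝒜 : OMDP S A) {B : 𝒜.EntrIdx → Finset (𝒜.ExitIdx → ℝ)}
    (hB : ∀ k, ∀ p ∈ B k, Subdist p) : (𝒜.shortcut B).M.SubProper := by
  refine MDP.Proper.subProper fun t q d hd => ?_
  rcases t with _ | s
  · cases hd
  · by_cases h : ∃ hs : s ∈ 𝒜.entr, q.1 ∈ B ⟨s, hs⟩
    · have hq := hB _ _ h.2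
      simp only [shortcut, dif_pos h, Option.some.injEq] at hd
      subst hd
      constructor
      · rintro (_ | s')
        · exact sub_nonneg.2 hq.2
        · refine Finset.sum_nonneg fun j _ => ?_
          split_ifs
          exacts [hq.1 j, le_rfl]
      · rw [Fintype.sum_option]
        simp only
        rw [Finset.sum_comm]
        simp
    · simp only [shortcut, dif_neg h] at hd
      cases hd

theorem PreWF.shortcut {𝒜 : OMDP S A} (h𝒜 : 𝒜.PreWF) {B : 𝒜.EntrIdx → Finset (𝒜.ExitIdx → ℝ)}
    (hB : ∀ k, ∀ p ∈ B k, Subdist p) : (𝒜.shortcut B).PreWF where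
  subProper := 𝒜.shortcut_subProper hB
  terminal_of_mem_exit := by
    intro t ht
    obtain ⟨s, hs, rfl⟩ : ∃ s ∈ 𝒜.exit, some s = t := by
      simpa [exit, OMDP.shortcut, or_and_right, exists_or] using ht
    exact 𝒜.shortcut_terminal_of_not_mem_entr B fun he => h𝒜.not_mem_exit_of_mem_entr he hs
  nodup := by
    have := h𝒜.nodup.map (Option.some_injective S)
    simpa [OMDP.shortcut] using this

end Shortcut

section SeqComp

variable {S₁ A₁ S₂ A₂ : Type} {𝒜 : OMDP S₁ A₁} {ℬ : OMDP S₂ A₂}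
  {h₁ : 𝒜.Or.length = ℬ.Ir.length} {h₂ : ℬ.Ol.length = 𝒜.Il.length}

theorem inl_mem_seqComp_exit {s : S₁} : Sum.inl s ∈ (𝒜.seqComp ℬ h₁ h₂).exit ↔ s ∈ 𝒜.Ol := by
  simp [exit, seqComp]

theorem inr_mem_seqComp_exit {s : S₂} : Sum.inr s ∈ (𝒜.seqComp ℬ h₁ h₂).exit ↔ s ∈ ℬ.Or := by
  simp [exit, seqComp]

theorem seqComp_prob_inl_get (h𝒜 : 𝒜.Or.Nodup) (k : Fin 𝒜.Or.length) (a : A₁ ⊕ A₂)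
    (t : S₁ ⊕ S₂) : (𝒜.seqComp ℬ h₁ h₂).M.prob (Sum.inl (𝒜.Or.get k)) a t =
      if t = Sum.inr (ℬ.Ir.get (Fin.cast h₁ k)) then 1 else 0 := by
  have h : ∃ k', 𝒜.Or.get k' = 𝒜.Or.get k := ⟨k, rfl⟩
  have hk : h.choose = k := List.nodup_iff_injective_get.1 h𝒜 h.choose_spec
  simp only [MDP.prob, seqComp, dif_pos h, Option.elim_some]
  rw [hk]

theorem seqComp_prob_inr_get (hℬ : ℬ.Ol.Nodup) (k : Fin ℬ.Ol.length) (a : A₁ ⊕ A₂)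
    (t : S₁ ⊕ S₂) : (𝒜.seqComp ℬ h₁ h₂).M.prob (Sum.inr (ℬ.Ol.get k)) a t =
      if t = Sum.inl (𝒜.Il.get (Fin.cast h₂ k)) then 1 else 0 := by
  have h : ∃ k', ℬ.Ol.get k' = ℬ.Ol.get k := ⟨k, rfl⟩
  have hk : h.choose = k := List.nodup_iff_injective_get.1 hℬ h.choose_spec
  simp only [MDP.prob, seqComp, dif_pos h, Option.elim_some]
  rw [hk]

theorem seqComp_P_inl {s : S₁} (hs : s ∉ 𝒜.Or) (a : A₁ ⊕ A₂) :
    (𝒜.seqComp ℬ h₁ h₂).M.P (Sum.inl s) a =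
      a.elim (fun a => (𝒜.M.P s a).map fun d => Sum.elim d fun _ => 0) fun _ => none := by
  rw [List.mem_iff_get] at hs
  simp only [seqComp, dif_neg hs]
  cases a <;> rfl

theorem seqComp_P_inr {s : S₂} (hs : s ∉ ℬ.Ol) (a : A₁ ⊕ A₂) :
    (𝒜.seqComp ℬ h₁ h₂).M.P (Sum.inr s) a =
      a.elim (fun _ => none) fun a => (ℬ.M.P s a).map fun d => Sum.elim (fun _ => 0) d := by
  rw [List.mem_iff_get] at hs
  simp only [seqComp, dif_neg hs]
  cases a <;> rfl

theorem seqComp_prob_inl {s : S₁} (hs : s ∉ 𝒜.Or) (a : A₁ ⊕ A₂) (t : S₁ ⊕ S₂) :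
    (𝒜.seqComp ℬ h₁ h₂).M.prob (Sum.inl s) a t =
      a.elim (fun a => t.elim (𝒜.M.prob s a) fun _ => 0) fun _ => 0 := by
  rw [MDP.prob, seqComp_P_inl hs]
  rcases a with a | a
  · rcases t with t | t <;> simp only [Sum.elim_inl, Sum.elim_inr, MDP.prob] <;>
      cases 𝒜.M.P s a <;> rfl
  · rfl

theorem seqComp_prob_inr {s : S₂} (hs : s ∉ ℬ.Ol) (a : A₁ ⊕ A₂) (t : S₁ ⊕ S₂) :
    (𝒜.seqComp ℬ h₁ h₂).M.prob (Sum.inr s) a t =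
      a.elim (fun _ => 0) fun a => t.elim (fun _ => 0) (ℬ.M.prob s a) := by
  rw [MDP.prob, seqComp_P_inr hs]
  rcases a with a | a
  · rfl
  · rcases t with t | t <;> simp only [Sum.elim_inl, Sum.elim_inr, MDP.prob] <;>
      cases ℬ.M.P s a <;> rfl

variable [Fintype S₁] [Fintype S₂]

theorem seqComp_backup_inl_get (h𝒜 : 𝒜.Or.Nodup) (k : Fin 𝒜.Or.length) (a : A₁ ⊕ A₂)
    (g : S₁ ⊕ S₂ → ℝ) : (𝒜.seqComp ℬ h₁ h₂).M.backup (Sum.inl (𝒜.Or.get k)) a g =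
      g (Sum.inr (ℬ.Ir.get (Fin.cast h₁ k))) := by
  simp [MDP.backup, seqComp_prob_inl_get h𝒜, -List.get_eq_getElem]

theorem seqComp_backup_inr_get (hℬ : ℬ.Ol.Nodup) (k : Fin ℬ.Ol.length) (a : A₁ ⊕ A₂)
    (g : S₁ ⊕ S₂ → ℝ) : (𝒜.seqComp ℬ h₁ h₂).M.backup (Sum.inr (ℬ.Ol.get k)) a g =
      g (Sum.inl (𝒜.Il.get (Fin.cast h₂ k))) := by
  simp [MDP.backup, seqComp_prob_inr_get hℬ, -List.get_eq_getElem]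

theorem seqComp_backup_inl {s : S₁} (hs : s ∉ 𝒜.Or) (a : A₁ ⊕ A₂) (g : S₁ ⊕ S₂ → ℝ) :
    (𝒜.seqComp ℬ h₁ h₂).M.backup (Sum.inl s) a g =
      a.elim (fun a => 𝒜.M.backup s a fun s' => g (Sum.inl s')) fun _ => 0 := by
  cases a <;> simp [MDP.backup, seqComp_prob_inl hs]

theorem seqComp_backup_inr {s : S₂} (hs : s ∉ ℬ.Ol) (a : A₁ ⊕ A₂) (g : S₁ ⊕ S₂ → ℝ) :
    (𝒜.seqComp ℬ h₁ h₂).M.backup (Sum.inr s) a g =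
      a.elim (fun _ => 0) fun a => ℬ.M.backup s a fun s' => g (Sum.inr s') := by
  cases a <;> simp [MDP.backup, seqComp_prob_inr hs]

theorem PreWF.seqComp_subProper (h𝒜 : 𝒜.PreWF) (hℬ : ℬ.PreWF) :
    (𝒜.seqComp ℬ h₁ h₂).M.SubProper := by
  constructor
  · rintro (s | s) a t
    · by_cases hs : s ∈ 𝒜.Or
      · obtain ⟨k, rfl⟩ := List.mem_iff_get.1 hs
        rw [seqComp_prob_inl_get h𝒜.nodup_Or]
        split_ifs <;> norm_num
      · rw [seqComp_prob_inl hs]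
        rcases a with a | a <;> rcases t with t | t <;>
          simp [h𝒜.subProper.nonneg]
    · by_cases hs : s ∈ ℬ.Ol
      · obtain ⟨k, rfl⟩ := List.mem_iff_get.1 hs
        rw [seqComp_prob_inr_get hℬ.nodup_Ol]
        split_ifs <;> norm_num
      · rw [seqComp_prob_inr hs]
        rcases a with a | a <;> rcases t with t | t <;>
          simp [hℬ.subProper.nonneg]
  · intro s a
    suffices h : (𝒜.seqComp ℬ h₁ h₂).M.backup s a (fun _ => 1) ≤ 1 by simpa [MDP.backup] using h
    rcases s with s | s
    · by_cases hs : s ∈ 𝒜.Or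
      · obtain ⟨k, rfl⟩ := List.mem_iff_get.1 hs
        rw [seqComp_backup_inl_get h𝒜.nodup_Or]
      · rw [seqComp_backup_inl hs]
        rcases a with a | a
        · exact h𝒜.subProper.backup_const_le s a zero_le_one
        · exact zero_le_one
    · by_cases hs : s ∈ ℬ.Ol
      · obtain ⟨k, rfl⟩ := List.mem_iff_get.1 hs
        rw [seqComp_backup_inr_get hℬ.nodup_Ol]
      · rw [seqComp_backup_inr hs]
        rcases a with a | a
        · exact zero_le_one
        · exact hℬ.subProper.backup_const_le s a zero_le_one

theorem PreWF.seqComp_terminal (h𝒜 : 𝒜.PreWF) (hℬ : ℬ.PreWF) :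
    ∀ t ∈ (𝒜.seqComp ℬ h₁ h₂).exit, (𝒜.seqComp ℬ h₁ h₂).M.terminal t := by
  rintro (s | s) ht a
  · rw [inl_mem_seqComp_exit] at ht
    rw [seqComp_P_inl fun h => h𝒜.disjoint_Or_Ol h ht]
    rcases a with a | a
    · simp [h𝒜.terminal_of_mem_exit s (by simp [exit, ht]) a]
    · rfl
  · rw [inr_mem_seqComp_exit] at ht
    rw [seqComp_P_inr (hℬ.disjoint_Or_Ol ht)]
    rcases a with a | a
    · rfl
    · simp [hℬ.terminal_of_mem_exit s (by simp [exit, ht]) a]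

theorem PreWF.seqComp_isExcessive_iff [Nonempty (A₁ ⊕ A₂)] (h𝒜 : 𝒜.PreWF) (hℬ : ℬ.PreWF)
    {w g : S₁ ⊕ S₂ → ℝ} (hw : ∀ t, t ∉ (𝒜.seqComp ℬ h₁ h₂).exit → w t = 0) :
    (𝒜.seqComp ℬ h₁ h₂).M.IsExcessive 1 w g ↔ (∀ t, w t ≤ g t) ∧
      (∀ (k : ℕ) (s : S₁) (t : S₂), 𝒜.Or[k]? = some s → ℬ.Ir[k]? = some t →
        g (Sum.inr t) ≤ g (Sum.inl s)) ∧
      (∀ (k : ℕ) (s : S₁) (t : S₂), ℬ.Ol[k]? = some t → 𝒜.Il[k]? = some s →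
        g (Sum.inl s) ≤ g (Sum.inr t)) ∧
      (∀ s, s ∉ 𝒜.Or → ∀ a,
        w (Sum.inl s) + 𝒜.M.backup s a (fun s' => g (Sum.inl s')) ≤ g (Sum.inl s)) ∧
      (∀ s, s ∉ ℬ.Ol → ∀ a,
        w (Sum.inr s) + ℬ.M.backup s a (fun s' => g (Sum.inr s')) ≤ g (Sum.inr s)) := by
  have hwl : ∀ k : Fin 𝒜.Or.length, w (Sum.inl (𝒜.Or.get k)) = 0 := fun k => hw _ fun h =>
    h𝒜.disjoint_Or_Ol (List.get_mem _ k) (inl_mem_seqComp_exit.1 h)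
  have hwr : ∀ k : Fin ℬ.Ol.length, w (Sum.inr (ℬ.Ol.get k)) = 0 := fun k => hw _ fun h =>
    hℬ.disjoint_Or_Ol (inr_mem_seqComp_exit.1 h) (List.get_mem _ k)
  constructor
  · intro h
    refine ⟨fun t => (h t).1, fun k s t hs ht => ?_, fun k s t ht hs => ?_, fun s hs a => ?_,
      fun s hs a => ?_⟩
    · obtain ⟨hk, rfl⟩ := List.getElem?_eq_some_iff.1 hs
      obtain ⟨_, rfl⟩ := List.getElem?_eq_some_iff.1 ht
      have := (h (Sum.inl (𝒜.Or.get ⟨k, hk⟩))).2 (Classical.arbitrary (A₁ ⊕ A₂))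
      rwa [seqComp_backup_inl_get h𝒜.nodup_Or, hwl, zero_add, one_mul] at this
    · obtain ⟨_, rfl⟩ := List.getElem?_eq_some_iff.1 hs
      obtain ⟨hk, rfl⟩ := List.getElem?_eq_some_iff.1 ht
      have := (h (Sum.inr (ℬ.Ol.get ⟨k, hk⟩))).2 (Classical.arbitrary (A₁ ⊕ A₂))
      rwa [seqComp_backup_inr_get hℬ.nodup_Ol, hwr, zero_add, one_mul] at this
    · simpa [seqComp_backup_inl hs] using (h (Sum.inl s)).2 (Sum.inl a)
    · simpa [seqComp_backup_inr hs] using (h (Sum.inr s)).2 (Sum.inr a)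
  · rintro ⟨h0, hl, hr, hL, hR⟩ t
    refine ⟨h0 t, fun a => ?_⟩
    rw [one_mul]
    rcases t with s | s
    · by_cases hs : s ∈ 𝒜.Or
      · obtain ⟨k, rfl⟩ := List.mem_iff_get.1 hs
        rw [seqComp_backup_inl_get h𝒜.nodup_Or, hwl, zero_add]
        exact hl k _ _ (List.getElem?_eq_getElem k.2)
          (List.getElem?_eq_getElem (h₁ ▸ k.2 : k.1 < ℬ.Ir.length))
      · rw [seqComp_backup_inl hs]
        rcases a with a | a
        · exact hL s hs a
        · simpa using h0 (Sum.inl s)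
    · by_cases hs : s ∈ ℬ.Ol
      · obtain ⟨k, rfl⟩ := List.mem_iff_get.1 hs
        rw [seqComp_backup_inr_get hℬ.nodup_Ol, hwr, zero_add]
        exact hr k _ _ (List.getElem?_eq_getElem k.2)
          (List.getElem?_eq_getElem (h₂ ▸ k.2 : k.1 < 𝒜.Il.length))
      · rw [seqComp_backup_inr hs]
        rcases a with a | a
        · simpa using h0 (Sum.inr s)
        · exact hR s hs a

end SeqComp

end OMDP

end SD

namespace SD

section PullExit

variable {S₁ A₁ S₂ A₂ : Type} {𝒳 : OMDP S₁ A₁} {𝒴 : OMDP S₂ A₂} {f : S₁ → S₂}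

theorem pullExit_surjective (hinj : f.Injective) (hf : ∀ s ∈ 𝒳.exit, f s ∈ 𝒴.exit) :
    (pullExit 𝒳 𝒴 f hf).Surjective :=
  Function.Injective.surjective_comp_right (γ := ℝ)
    (f := fun j : 𝒳.ExitIdx => (⟨f j.1, hf j.1 j.2⟩ : 𝒴.ExitIdx))
    fun _ _ h => Subtype.ext (hinj (Subtype.ext_iff.1 h))

theorem sum_mul_pullExit (hinj : f.Injective) (hf : ∀ s ∈ 𝒳.exit, f s ∈ 𝒴.exit)
    (hsurj : ∀ t ∈ 𝒴.exit, ∃ s ∈ 𝒳.exit, f s = t) (w : S₂ → ℝ) (p : 𝒴.ExitIdx → ℝ) :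
    ∑ j : 𝒳.ExitIdx, w (f j.1) * pullExit 𝒳 𝒴 f hf p j = ∑ j : 𝒴.ExitIdx, w j.1 * p j := by
  have hbij : Function.Bijective fun j : 𝒳.ExitIdx => (⟨f j.1, hf j.1 j.2⟩ : 𝒴.ExitIdx) := by
    refine ⟨fun _ _ h => Subtype.ext (hinj (Subtype.ext_iff.1 h)), fun t => ?_⟩
    obtain ⟨s, hs, h⟩ := hsurj t.1 t.2
    exact ⟨⟨s, hs⟩, Subtype.ext h⟩
  exact hbij.sum_comp fun j : 𝒴.ExitIdx => w j.1 * p j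

end PullExit

namespace OMDP

section Shortcut

variable {S A : Type} [Fintype S]

theorem WF.nonempty_action {𝒜 : OMDP S A} (h𝒜 : 𝒜.WF) {k : S} (hk : k ∈ 𝒜.entr) : Nonempty A := by
  by_contra h
  exact h𝒜.preWF.not_mem_exit_of_mem_entr hk ((h𝒜.2.2 k).2 fun a => (h ⟨a⟩).elim)

variable [Fintype A]

theorem achievable_nonempty {𝒜 : OMDP S A} (hM : 𝒜.M.SubProper) (i : S) :
    (𝒜.achievable i).Nonempty := by
  obtain ⟨δ, hδ, -⟩ := MDP.exists_optimal_selector hM (w := 0) le_rfl (by simp)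
  exact ⟨_, MDP.selSched δ, hδ.isSched, le_rfl⟩

variable {𝒜 : OMDP S A} {V : 𝒜.EntrIdx → Finset (𝒜.ExitIdx → ℝ)}

theorem nonempty_shortAct (hM : 𝒜.M.SubProper)
    (hgen : ∀ k : 𝒜.EntrIdx,
      𝒜.achievable k.1 = dwConv ((V k : Finset (𝒜.ExitIdx → ℝ)) : Set (𝒜.ExitIdx → ℝ)))
    {k : S} (hk : k ∈ 𝒜.entr) : Nonempty (𝒜.ShortAct V) := by
  have h := achievable_nonempty hM k
  rw [hgen ⟨k, hk⟩] at h
  obtain ⟨_, _, h, -⟩ := h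
  obtain ⟨q, hq⟩ := convexHull_nonempty_iff.1 ⟨_, h⟩
  exact ⟨q, _, hq⟩

/-- An excessive function of an open MDP induces one of its shortcut. -/
theorem PreWF.shortcut_backup_le (h𝒜 : 𝒜.PreWF)
    (hgen : ∀ k : 𝒜.EntrIdx,
      𝒜.achievable k.1 = dwConv ((V k : Finset (𝒜.ExitIdx → ℝ)) : Set (𝒜.ExitIdx → ℝ)))
    {w g : S → ℝ} (hg0 : 0 ≤ g) (hwg : w ≤ g) (hw : ∀ s, s ∉ 𝒜.exit → w s = 0)
    (hg : ∀ s, s ∉ 𝒜.exit → ∀ a, 𝒜.M.backup s a g ≤ g s) (t : Option S) (q : 𝒜.ShortAct V) :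
    t.elim 0 w + (𝒜.shortcut V).M.backup t q (fun t => t.elim 0 g) ≤ t.elim 0 g := by
  rcases t with _ | s
  · simp [shortcut_backup_none]
  · by_cases h : ∃ hs : s ∈ 𝒜.entr, q.1 ∈ V ⟨s, hs⟩
    · rw [𝒜.shortcut_backup_of_mem h]
      simpa [hw s (h𝒜.not_mem_exit_of_mem_entr h.1)] using
        sum_mul_le_of_backup_le h𝒜 hgen hg0 hg h.2
    · rw [𝒜.shortcut_backup_of_not_mem h]
      simpa using hwg s

/-- An excessive function of the shortcut of an open MDP induces one of the open MDP itself. -/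
theorem PreWF.exists_backup_le (h𝒜 : 𝒜.PreWF) (hV : ∀ k, ∀ p ∈ V k, Subdist p)
    (hgen : ∀ k : 𝒜.EntrIdx,
      𝒜.achievable k.1 = dwConv ((V k : Finset (𝒜.ExitIdx → ℝ)) : Set (𝒜.ExitIdx → ℝ)))
    {g : Option S → ℝ} (hg0 : 0 ≤ g)
    (hg : ∀ s ∈ 𝒜.entr, ∀ q, (𝒜.shortcut V).M.backup (some s) q g ≤ g (some s)) :
    ∃ f : S → ℝ, 0 ≤ f ∧ (∀ s, s ∉ 𝒜.exit → ∀ a, 𝒜.M.backup s a f ≤ f s) ∧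
      (∀ s ∈ 𝒜.exit, f s = g (some s)) ∧ ∀ s ∈ 𝒜.entr, f s ≤ g (some s) := by
  set u : S → ℝ := fun s => if s ∈ 𝒜.exit then g (some s) else 0 with hu
  have hue : ∀ s ∈ 𝒜.exit, u s = g (some s) := fun s hs => if_pos hs
  have hu0 : 0 ≤ u := fun s => by
    simp only [hu, Pi.zero_apply]
    split_ifs
    exacts [hg0 _, le_rfl]
  have hu1 : ∀ s, s ∉ 𝒜.exit → u s = 0 := fun s hs => if_neg hs
  obtain ⟨f, hf, hfe, hfk⟩ := exists_isExcessive_le h𝒜 hgen hu0 hu1 (c := fun s => g (some s))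
    fun k q hq => by
      have h1 := hg k.1 k.2 ⟨q, k, hq⟩
      rw [𝒜.shortcut_backup_of_mem ⟨k.2, hq⟩] at h1
      have h2 := mul_nonneg (sub_nonneg.2 (hV k q hq).2) (hg0 none)
      have h3 : ∑ j, q j * u j.1 = ∑ j, q j * g (some j.1) :=
        Finset.sum_congr rfl fun j _ => by rw [hue _ j.2]
      rw [h3]
      linarith
  refine ⟨f, fun s => (hu0 s).trans (hf s).1, fun s hs a => ?_,
    fun s hs => (hfe s hs).trans (hue s hs), hfk⟩
  simpa [hu1 s hs] using (hf s).2 a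

end Shortcut

section SeqComp

variable {S₁ A₁ S₂ A₂ : Type} {𝒜 : OMDP S₁ A₁} {ℬ : OMDP S₂ A₂}
  {h₁ : 𝒜.Or.length = ℬ.Ir.length} {h₂ : ℬ.Ol.length = 𝒜.Il.length}
  {VA : 𝒜.EntrIdx → Finset (𝒜.ExitIdx → ℝ)} {VB : ℬ.EntrIdx → Finset (ℬ.ExitIdx → ℝ)}
  {g₁ : (𝒜.shortcut VA).Or.length = (ℬ.shortcut VB).Ir.length}
  {g₂ : (ℬ.shortcut VB).Ol.length = (𝒜.shortcut VA).Il.length}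

theorem mem_shortcut_seqComp_exit {t : Option S₁ ⊕ Option S₂} :
    t ∈ ((𝒜.shortcut VA).seqComp (ℬ.shortcut VB) g₁ g₂).exit ↔
      ∃ s ∈ (𝒜.seqComp ℬ h₁ h₂).exit, Sum.map some some s = t := by
  rcases t with t | t
  · simp [inl_mem_seqComp_exit, shortcut]
  · simp [inr_mem_seqComp_exit, shortcut]

variable [Fintype S₁] [Fintype A₁] [Fintype S₂] [Fintype A₂]
  [Nonempty (A₁ ⊕ A₂)] [Nonempty (𝒜.ShortAct VA ⊕ ℬ.ShortAct VB)]

theorem isExcessive_shortcut_seqComp (h𝒜 : 𝒜.PreWF) (hℬ : ℬ.PreWF)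
    (hVA : ∀ k, ∀ p ∈ VA k, Subdist p) (hVB : ∀ k, ∀ p ∈ VB k, Subdist p)
    (hgenA : ∀ k : 𝒜.EntrIdx,
      𝒜.achievable k.1 = dwConv ((VA k : Finset (𝒜.ExitIdx → ℝ)) : Set (𝒜.ExitIdx → ℝ)))
    (hgenB : ∀ k : ℬ.EntrIdx,
      ℬ.achievable k.1 = dwConv ((VB k : Finset (ℬ.ExitIdx → ℝ)) : Set (ℬ.ExitIdx → ℝ)))
    {w g : S₁ ⊕ S₂ → ℝ} (hw0 : 0 ≤ w) (hw : ∀ t, t ∉ (𝒜.seqComp ℬ h₁ h₂).exit → w t = 0)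
    (hg : (𝒜.seqComp ℬ h₁ h₂).M.IsExcessive 1 w g) :
    ∃ w' g' : Option S₁ ⊕ Option S₂ → ℝ, 0 ≤ w' ∧
      (∀ t, t ∉ ((𝒜.shortcut VA).seqComp (ℬ.shortcut VB) g₁ g₂).exit → w' t = 0) ∧
      ((𝒜.shortcut VA).seqComp (ℬ.shortcut VB) g₁ g₂).M.IsExcessive 1 w' g' ∧
      (∀ t, w' (Sum.map some some t) = w t) ∧ ∀ t, g' (Sum.map some some t) = g t := by
  have hg0 : 0 ≤ g := fun t => (hw0 t).trans (hg t).1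
  obtain ⟨hwg, hl, hr, hL, hR⟩ := (h𝒜.seqComp_isExcessive_iff hℬ hw).1 hg
  have hw'0 : ∀ t, t ∉ ((𝒜.shortcut VA).seqComp (ℬ.shortcut VB) g₁ g₂).exit →
      Sum.elim (fun t => t.elim 0 fun s => w (Sum.inl s))
        (fun t => t.elim 0 fun s => w (Sum.inr s)) t = 0 := by
    intro t ht
    rw [mem_shortcut_seqComp_exit (h₁ := h₁) (h₂ := h₂)] at ht
    rcases t with (_ | s) | (_ | s)
    · rfl
    · exact hw _ fun h => ht ⟨_, h, rfl⟩
    · rfl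
    · exact hw _ fun h => ht ⟨_, h, rfl⟩
  refine ⟨Sum.elim (fun t => t.elim 0 fun s => w (Sum.inl s))
      (fun t => t.elim 0 fun s => w (Sum.inr s)),
    Sum.elim (fun t => t.elim 0 fun s => g (Sum.inl s))
      (fun t => t.elim 0 fun s => g (Sum.inr s)), ?_, hw'0, ?_, ?_, ?_⟩
  · rintro ((_ | s) | (_ | s))
    exacts [le_rfl, hw0 _, le_rfl, hw0 _]
  · refine ((h𝒜.shortcut hVA).seqComp_isExcessive_iff (hℬ.shortcut hVB) hw'0).2
      ⟨?_, ?_, ?_, ?_, ?_⟩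
    · rintro ((_ | s) | (_ | s))
      exacts [le_rfl, hwg _, le_rfl, hwg _]
    · intro k s t hs ht
      obtain ⟨s, hs', rfl⟩ : ∃ s', 𝒜.Or[k]? = some s' ∧ some s' = s := by
        simpa [OMDP.shortcut] using hs
      obtain ⟨t, ht', rfl⟩ : ∃ t', ℬ.Ir[k]? = some t' ∧ some t' = t := by
        simpa [OMDP.shortcut] using ht
      exact hl k s t hs' ht'
    · intro k s t ht hs
      obtain ⟨s, hs', rfl⟩ : ∃ s', 𝒜.Il[k]? = some s' ∧ some s' = s := by
        simpa [OMDP.shortcut] using hs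
      obtain ⟨t, ht', rfl⟩ : ∃ t', ℬ.Ol[k]? = some t' ∧ some t' = t := by
        simpa [OMDP.shortcut] using ht
      exact hr k s t ht' hs'
    · intro t _ q
      refine h𝒜.shortcut_backup_le hgenA (fun s => hg0 (Sum.inl s)) (fun s => hwg (Sum.inl s))
        (fun s hs => ?_) (fun s hs a => ?_) t q
      · exact hw _ fun h => hs (List.mem_append_right _ (inl_mem_seqComp_exit.1 h))
      · refine le_trans ?_ (hL s (fun h => hs (List.mem_append_left _ h)) a)
        exact le_add_of_nonneg_left (hw0 _)
    · intro t _ q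
      refine hℬ.shortcut_backup_le hgenB (fun s => hg0 (Sum.inr s)) (fun s => hwg (Sum.inr s))
        (fun s hs => ?_) (fun s hs a => ?_) t q
      · exact hw _ fun h => hs (List.mem_append_left _ (inr_mem_seqComp_exit.1 h))
      · refine le_trans ?_ (hR s (fun h => hs (List.mem_append_right _ h)) a)
        exact le_add_of_nonneg_left (hw0 _)
  · rintro (s | s) <;> rfl
  · rintro (s | s) <;> rfl

theorem exists_isExcessive_seqComp_le (h𝒜 : 𝒜.PreWF) (hℬ : ℬ.PreWF)
    (hVA : ∀ k, ∀ p ∈ VA k, Subdist p) (hVB : ∀ k, ∀ p ∈ VB k, Subdist p)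
    (hgenA : ∀ k : 𝒜.EntrIdx,
      𝒜.achievable k.1 = dwConv ((VA k : Finset (𝒜.ExitIdx → ℝ)) : Set (𝒜.ExitIdx → ℝ)))
    (hgenB : ∀ k : ℬ.EntrIdx,
      ℬ.achievable k.1 = dwConv ((VB k : Finset (ℬ.ExitIdx → ℝ)) : Set (ℬ.ExitIdx → ℝ)))
    {w g : Option S₁ ⊕ Option S₂ → ℝ} (hw0 : 0 ≤ w)
    (hw : ∀ t, t ∉ ((𝒜.shortcut VA).seqComp (ℬ.shortcut VB) g₁ g₂).exit → w t = 0)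
    (hg : ((𝒜.shortcut VA).seqComp (ℬ.shortcut VB) g₁ g₂).M.IsExcessive 1 w g) :
    ∃ f : S₁ ⊕ S₂ → ℝ,
      (∀ t, t ∉ (𝒜.seqComp ℬ h₁ h₂).exit → w (Sum.map some some t) = 0) ∧
      (𝒜.seqComp ℬ h₁ h₂).M.IsExcessive 1 (fun t => w (Sum.map some some t)) f ∧
      ∀ t ∈ (𝒜.seqComp ℬ h₁ h₂).entr, f t ≤ g (Sum.map some some t) := by
  have hg0 : 0 ≤ g := fun t => (hw0 t).trans (hg t).1
  have hwC : ∀ t, t ∉ (𝒜.seqComp ℬ h₁ h₂).exit → w (Sum.map some some t) = 0 := by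
    refine fun t ht => hw _ fun h => ht ?_
    obtain ⟨s, hs, hst⟩ := mem_shortcut_seqComp_exit.1 h
    exact (Option.some_injective _).sumMap (Option.some_injective _) hst ▸ hs
  obtain ⟨hwg, hl, hr, hL, hR⟩ :=
    ((h𝒜.shortcut hVA).seqComp_isExcessive_iff (hℬ.shortcut hVB) hw).1 hg
  obtain ⟨f₁, hf₁0, hf₁, hf₁e, hf₁k⟩ := h𝒜.exists_backup_le hVA hgenA
    (g := fun t => g (Sum.inl t)) (fun t => hg0 _) fun s hs q => by
      refine le_trans ?_ (hL (some s) (fun h => ?_) q)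
      · exact le_add_of_nonneg_left (hw0 _)
      · exact h𝒜.not_mem_exit_of_mem_entr hs
          (List.mem_append_left _ (by simpa [OMDP.shortcut] using h))
  obtain ⟨f₂, hf₂0, hf₂, hf₂e, hf₂k⟩ := hℬ.exists_backup_le hVB hgenB
    (g := fun t => g (Sum.inr t)) (fun t => hg0 _) fun s hs q => by
      refine le_trans ?_ (hR (some s) (fun h => ?_) q)
      · exact le_add_of_nonneg_left (hw0 _)
      · exact hℬ.not_mem_exit_of_mem_entr hs
          (List.mem_append_right _ (by simpa [OMDP.shortcut] using h))
  have hwf : ∀ t, w (Sum.map some some t) ≤ Sum.elim f₁ f₂ t := by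
    intro t
    by_cases ht : t ∈ (𝒜.seqComp ℬ h₁ h₂).exit
    · rcases t with s | s
      · exact (hwg _).trans_eq (hf₁e s (List.mem_append_right _ (inl_mem_seqComp_exit.1 ht))).symm
      · exact (hwg _).trans_eq (hf₂e s (List.mem_append_left _ (inr_mem_seqComp_exit.1 ht))).symm
    · rw [hwC t ht]
      rcases t with s | s
      exacts [hf₁0 s, hf₂0 s]
  refine ⟨Sum.elim f₁ f₂, hwC, (h𝒜.seqComp_isExcessive_iff hℬ hwC).2
    ⟨hwf, ?_, ?_, ?_, ?_⟩, ?_⟩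
  · intro k s t hs ht
    have h := hl k (some s) (some t) (by simp [OMDP.shortcut, hs]) (by simp [OMDP.shortcut, ht])
    exact (hf₂k t (List.mem_append_left _ (List.mem_of_getElem? ht))).trans
      (h.trans_eq (hf₁e s (List.mem_append_left _ (List.mem_of_getElem? hs))).symm)
  · intro k s t ht hs
    have h := hr k (some s) (some t) (by simp [OMDP.shortcut, ht]) (by simp [OMDP.shortcut, hs])
    exact (hf₁k s (List.mem_append_right _ (List.mem_of_getElem? hs))).trans
      (h.trans_eq (hf₂e t (List.mem_append_right _ (List.mem_of_getElem? ht))).symm)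
  · intro s hs a
    by_cases he : s ∈ 𝒜.exit
    · rw [(h𝒜.terminal_of_mem_exit s he).backup_eq_zero, add_zero]
      exact hwf (Sum.inl s)
    · rw [hwC _ fun h => he (List.mem_append_right _ (inl_mem_seqComp_exit.1 h)), zero_add]
      exact hf₁ s he a
  · intro s hs a
    by_cases he : s ∈ ℬ.exit
    · rw [(hℬ.terminal_of_mem_exit s he).backup_eq_zero, add_zero]
      exact hwf (Sum.inr s)
    · rw [hwC _ fun h => he (List.mem_append_left _ (inr_mem_seqComp_exit.1 h)), zero_add]
      exact hf₂ s he a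
  · rintro (s | s) hs
    · exact hf₁k s (List.mem_append_left _ (by simpa [entr, seqComp] using hs))
    · exact hf₂k s (List.mem_append_right _ (by simpa [entr, seqComp] using hs))

end SeqComp

end OMDP

end SD

open SD in
/-- For open MDPs `𝒜`, `ℬ` whose sequential composition `𝒜 ⨟ ℬ`
is well-defined: the achievable sets of `𝒜 ⨟ ℬ` equal the achievable sets of
`D(A^𝒜) ⨟ D(A^ℬ)`, where `D(A^𝒜)` and `D(A^ℬ)` are the shortcut oMDPs of the
vertex families `VA`, `VB` of the achievable sets of `𝒜` and `ℬ`: for every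
entrance `i` of `𝒜 ⨟ ℬ`, `A^{𝒜⨟ℬ}(i) = A^{D(A^𝒜)⨟D(A^ℬ)}(i)` (achievable sets
of the composed shortcut transported along `s ↦ Sum.map some some s`). -/
theorem statement_7 {S₁ A₁ S₂ A₂ : Type}
    [Fintype S₁] [Fintype A₁] [Fintype S₂] [Fintype A₂]
    (𝒜 : OMDP S₁ A₁) (ℬ : OMDP S₂ A₂) (hWFA : 𝒜.WF) (hWFB : ℬ.WF)
    (h₁ : 𝒜.Or.length = ℬ.Ir.length) (h₂ : ℬ.Ol.length = 𝒜.Il.length)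
    (VA : 𝒜.EntrIdx → Finset (𝒜.ExitIdx → ℝ))
    (VB : ℬ.EntrIdx → Finset (ℬ.ExitIdx → ℝ))
    (hVA : ∀ k, ∀ p ∈ VA k, Subdist p) (hVB : ∀ k, ∀ p ∈ VB k, Subdist p)
    (hgenA : ∀ k : 𝒜.EntrIdx,
      𝒜.achievable k.1 = dwConv ((VA k : Finset (𝒜.ExitIdx → ℝ)) : Set (𝒜.ExitIdx → ℝ)))
    (hgenB : ∀ k : ℬ.EntrIdx,
      ℬ.achievable k.1 = dwConv ((VB k : Finset (ℬ.ExitIdx → ℝ)) : Set (ℬ.ExitIdx → ℝ)))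
    (g₁ : (𝒜.shortcut VA).Or.length = (ℬ.shortcut VB).Ir.length)
    (g₂ : (ℬ.shortcut VB).Ol.length = (𝒜.shortcut VA).Il.length)
    (hmem : ∀ s ∈ (𝒜.seqComp ℬ h₁ h₂).exit,
      Sum.map some some s ∈ ((𝒜.shortcut VA).seqComp (ℬ.shortcut VB) g₁ g₂).exit)
    (i : S₁ ⊕ S₂) (hi : i ∈ (𝒜.seqComp ℬ h₁ h₂).entr) :
    (𝒜.seqComp ℬ h₁ h₂).achievable i =
      pullExit (𝒜.seqComp ℬ h₁ h₂) ((𝒜.shortcut VA).seqComp (ℬ.shortcut VB) g₁ g₂)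
        (Sum.map some some) hmem ''
        ((𝒜.shortcut VA).seqComp (ℬ.shortcut VB) g₁ g₂).achievable (Sum.map some some i) := by
  have h𝒜 := hWFA.preWF
  have hℬ := hWFB.preWF
  have hne : Nonempty (A₁ ⊕ A₂) ∧ Nonempty (𝒜.ShortAct VA ⊕ ℬ.ShortAct VB) := by
    rcases i with k | k
    · have hk : k ∈ 𝒜.entr := List.mem_append_left _ (by simpa [OMDP.entr, OMDP.seqComp] using hi)
      exact ⟨(hWFA.nonempty_action hk).map Sum.inl,
        (OMDP.nonempty_shortAct h𝒜.subProper hgenA hk).map Sum.inl⟩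
    · have hk : k ∈ ℬ.entr := List.mem_append_right _ (by simpa [OMDP.entr, OMDP.seqComp] using hi)
      exact ⟨(hWFB.nonempty_action hk).map Sum.inr,
        (OMDP.nonempty_shortAct hℬ.subProper hgenB hk).map Sum.inr⟩
  obtain ⟨_, _⟩ := hne
  have hinj : Function.Injective (Sum.map some some : S₁ ⊕ S₂ → _) :=
    (Option.some_injective _).sumMap (Option.some_injective _)
  have hsum := sum_mul_pullExit hinj hmem fun t ht => OMDP.mem_shortcut_seqComp_exit.1 ht
  have hC := OMDP.mem_achievable_iff (h𝒜.seqComp_subProper (h₁ := h₁) (h₂ := h₂) hℬ)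
    (h𝒜.seqComp_terminal hℬ) i
  have hD := OMDP.mem_achievable_iff
    ((h𝒜.shortcut hVA).seqComp_subProper (h₁ := g₁) (h₂ := g₂) (hℬ.shortcut hVB))
    ((h𝒜.shortcut hVA).seqComp_terminal (hℬ.shortcut hVB)) (Sum.map some some i)
  ext p
  constructor
  · intro hp
    obtain ⟨p, rfl⟩ := pullExit_surjective hinj hmem p
    refine ⟨p, (hD p).2 fun w g hw0 hw hg => ?_, rfl⟩
    obtain ⟨f, hwC, hf, hfg⟩ :=
      OMDP.exists_isExcessive_seqComp_le h𝒜 hℬ hVA hVB hgenA hgenB hw0 hw hg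
    rw [← hsum]
    exact ((hC _).1 hp _ f (fun t => hw0 _) hwC hf).trans (hfg i hi)
  · rintro ⟨p, hp, rfl⟩
    refine (hC _).2 fun w g hw0 hw hg => ?_
    obtain ⟨w', g', hw'0, hw', hg', hww, hgg⟩ :=
      OMDP.isExcessive_shortcut_seqComp h𝒜 hℬ hVA hVB hgenA hgenB hw0 hw hg
    have h := (hD p).1 hp w' g' hw'0 hw' hg'
    rw [← hsum, hgg] at h
    simpa only [hww] using h
end

section
/- Let 𝒜, ℬ be open MDPs and let (L^𝒜,U^𝒜) and (L^ℬ,U^ℬ) be sound approximations of 𝒜 and ℬ respectively. Then the pair of families of achievable sets of D(L^𝒜)⊕D(L^ℬ) and of D(U^𝒜)⊕D(U^ℬ) is a sound approximation of the sum 𝒜⊕ℬ; that is, for every entrance i of 𝒜⊕ℬ: A^{D(L^𝒜)⊕D(L^ℬ)}(i) ⊆ A^{𝒜⊕ℬ}(i) ⊆ A^{D(U^𝒜)⊕D(U^ℬ)}(i). -/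
open scoped Classical ENNReal

namespace SD

namespace OMDP

variable {S₁ A₁ S₂ A₂ : Type}

/-- The sum `𝒜 ⊕ ℬ` of open MDPs: the disjoint union of the two oMDPs, with
transitions inherited from each component (and none between components), and
open ends the concatenations of the respective open ends. -/
def sumComp (𝒜 : OMDP S₁ A₁) (ℬ : OMDP S₂ A₂) : OMDP (S₁ ⊕ S₂) (A₁ ⊕ A₂) where
  M := ⟨fun t a =>
    match t, a with
    | Sum.inl s, Sum.inl a => (𝒜.M.P s a).map fun d => Sum.elim d fun _ => 0
    | Sum.inr s, Sum.inr a => (ℬ.M.P s a).map fun d => Sum.elim (fun _ => 0) d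
    | _, _ => none⟩
  Ir := 𝒜.Ir.map Sum.inl ++ ℬ.Ir.map Sum.inr
  Il := 𝒜.Il.map Sum.inl ++ ℬ.Il.map Sum.inr
  Or := 𝒜.Or.map Sum.inl ++ ℬ.Or.map Sum.inr
  Ol := 𝒜.Ol.map Sum.inl ++ ℬ.Ol.map Sum.inr

end OMDP

end SD

namespace SD

namespace FinPath

variable {S A S' A' : Type}

/-- The image of a finite path under maps of states and actions. -/
def map (f : S → S') (g : A → A') (π : FinPath S A) : FinPath S' A' :=
  ⟨f π.start, π.steps.map (Prod.map g f)⟩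

theorem last_map (f : S → S') (g : A → A') (π : FinPath S A) :
    (π.map f g).last = f π.last := by
  rcases π with ⟨s, l⟩
  have h : ∀ (l : List (A × S)) (s : S),
      ((l.map (Prod.map g f)).map Prod.snd).getLastD (f s) =
        f ((l.map Prod.snd).getLastD s) := by
    intro l
    induction l with
    | nil => intro s; rfl
    | cons x l ih => intro s; simpa only [List.map_cons, List.getLastD_cons, Prod.map_snd] using ih x.2
  exact h l s

theorem last_snoc_s8 (π : FinPath S A) (a : A) (s : S) : (π.snoc a s).last = s := by
  simp [last, snoc, List.getLastD_eq_getLast?]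

theorem map_snoc (f : S → S') (g : A → A') (π : FinPath S A) (a : A) (s : S) :
    (π.snoc a s).map f g = (π.map f g).snoc (g a) (f s) := by
  simp [map, snoc]

theorem map_injective {f : S → S'} {g : A → A'} (hf : Function.Injective f)
    (hg : Function.Injective g) : Function.Injective (map f g) := by
  rintro ⟨s, l⟩ ⟨s', l'⟩ h
  simp only [map, FinPath.mk.injEq] at h
  rw [hf h.1, (hg.prodMap hf).list_map h.2]

end FinPath

namespace MDP

section Basic

variable {S A : Type}

theorem prob_eq_zero_of_not_enabled {M : MDP S A} {s : S} {a : A} (h : ¬M.enabled s a) (t : S) :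
    M.prob s a t = 0 := by
  have h' : M.P s a = none := by simpa [enabled] using h
  simp [prob, h']

variable [Fintype A]

/-- Every MDP has a scheduler. -/
theorem exists_isSched [Fintype S] (M : MDP S A) : ∃ σ : Sched S A, M.IsSched σ := by
  refine ⟨fun π => if h : ∃ a, M.enabled π.last a then Pi.single h.choose 1 else 0, ?_⟩
  intro π _
  by_cases h : ∃ a, M.enabled π.last a
  · simp only [dif_pos h]
    refine ⟨fun a => ?_, fun a ha => ?_, fun _ => ?_⟩
    · by_cases hc : a = h.choose
      · subst hc; simp
      · simp [hc]
    · by_cases hc : a = h.choose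
      · rw [hc]; exact h.choose_spec
      · simp [hc] at ha
    · simp
  · simp only [dif_neg h]
    refine ⟨fun _ => le_rfl, fun a ha => absurd rfl ha, fun ht => absurd ?_ ht⟩
    intro a
    by_contra hc
    exact h ⟨a, hc⟩

variable [Fintype S]

theorem reachN_empty (M : MDP S A) (σ : Sched S A) (n : ℕ) (π : FinPath S A) :
    M.reachN σ ∅ n π = 0 := by
  induction n generalizing π with
  | zero => simp [reachN]
  | succ n ih => simp [reachN, ih]

theorem Pr_empty (M : MDP S A) (σ : Sched S A) (s : S) : M.Pr σ s ∅ = 0 := by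
  simp [Pr, reachN_empty]

theorem Pr_nonneg (M : MDP S A) (σ : Sched S A) (s : S) (T : Set S) : 0 ≤ M.Pr σ s T := by
  unfold Pr
  by_cases hb : BddAbove (Set.range fun n : ℕ => M.reachN σ T n ⟨s, []⟩)
  · refine le_trans ?_ (le_ciSup hb 0)
    simp only [reachN]
    split_ifs <;> norm_num
  · rw [Real.iSup_of_not_bddAbove hb]

theorem reachN_of_terminal {M : MDP S A} (σ : Sched S A) (T : Set S) (n : ℕ) {π : FinPath S A}
    (h : M.terminal π.last) : M.reachN σ T n π = if π.last ∈ T then 1 else 0 := by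
  cases n with
  | zero => rfl
  | succ n =>
    have h0 : ∀ a t, M.prob π.last a t = 0 := fun a t => by simp [prob, h a]
    simp [reachN, h0]

/-- Reachability from a state all of whose successors are terminal. -/
theorem Pr_eq_sum_of_successors_terminal {M : MDP S A} {σ : Sched S A} {s t : S} (hst : s ≠ t)
    (hterm : ∀ a s', M.prob s a s' ≠ 0 → M.terminal s')
    (hnn : 0 ≤ ∑ a, σ ⟨s, []⟩ a * M.prob s a t) :
    M.Pr σ s {t} = ∑ a, σ ⟨s, []⟩ a * M.prob s a t := by
  have hs : (⟨s, []⟩ : FinPath S A).last = s := rfl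
  have h0 : M.reachN σ {t} 0 ⟨s, []⟩ = 0 := by simp [reachN, hs, hst]
  have hsucc : ∀ n, M.reachN σ {t} (n + 1) ⟨s, []⟩ = ∑ a, σ ⟨s, []⟩ a * M.prob s a t := by
    intro n
    simp only [reachN, hs, Set.mem_singleton_iff, hst, if_false]
    refine Finset.sum_congr rfl fun a _ => ?_
    congr 1
    rw [Finset.sum_eq_single t]
    · by_cases h : M.prob s a t = 0
      · simp [h]
      · rw [reachN_of_terminal]
        · simp [FinPath.last_snoc_s8]
        · rw [FinPath.last_snoc_s8]; exact hterm a t h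
    · intro s' _ hne
      by_cases h : M.prob s a s' = 0
      · simp [h]
      · rw [reachN_of_terminal]
        · simp [FinPath.last_snoc_s8, hne]
        · rw [FinPath.last_snoc_s8]; exact hterm a s' h
    · simp
  have hle : ∀ n, M.reachN σ {t} n ⟨s, []⟩ ≤ ∑ a, σ ⟨s, []⟩ a * M.prob s a t := by
    intro n
    cases n with
    | zero => rw [h0]; exact hnn
    | succ n => exact (hsucc n).le
  refine le_antisymm (ciSup_le hle) ?_
  rw [← hsucc 0]
  exact le_ciSup (f := fun n => M.reachN σ {t} n ⟨s, []⟩) ⟨_, Set.forall_mem_range.2 hle⟩ 1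

end Basic

/-- An embedding of an MDP as a part of another MDP that is never left. -/
structure Embeds {S A S' A' : Type} (M : MDP S A) (M' : MDP S' A') (f : S → S') (g : A → A') :
    Prop where
  state_inj : Function.Injective f
  act_inj : Function.Injective g
  prob_map : ∀ s a t, M'.prob (f s) (g a) (f t) = M.prob s a t
  prob_of_notMem_range : ∀ s a t, t ∉ Set.range f → M'.prob (f s) a t = 0
  enabled_map : ∀ s a, M'.enabled (f s) (g a) ↔ M.enabled s a
  not_enabled : ∀ s a, a ∉ Set.range g → ¬M'.enabled (f s) a

namespace Embeds

variable {S A S' A' : Type} {M : MDP S A} {M' : MDP S' A'} {f : S → S'} {g : A → A'}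

theorem preimage_singleton (h : M.Embeds M' f g) (s : S) : f ⁻¹' {f s} = {s} := by
  ext t
  exact h.state_inj.eq_iff

theorem terminal_map (h : M.Embeds M' f g) (s : S) : M'.terminal (f s) ↔ M.terminal s := by
  constructor
  · intro ht a
    by_contra hc
    exact (h.enabled_map s a).2 hc (ht (g a))
  · intro ht a
    by_contra hc
    by_cases hr : a ∈ Set.range g
    · obtain ⟨a, rfl⟩ := hr
      exact (h.enabled_map s a).1 hc (ht a)
    · exact h.not_enabled s a hr hc

theorem consistent_map (h : M.Embeds M' f g) (π : FinPath S A) :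
    M'.Consistent (π.map f g) ↔ M.Consistent π := by
  rcases π with ⟨s, l⟩
  simp only [Consistent, FinPath.map]
  induction l generalizing s with
  | nil => simp [ConsistentFrom]
  | cons x l ih =>
    rcases x with ⟨a, t⟩
    simp only [List.map_cons, Prod.map, ConsistentFrom, h.prob_map]
    rw [ih]

variable [Fintype A] [Fintype A']

theorem sum_act (h : M.Embeds M' f g) (F : A' → ℝ) (hF : ∀ a, a ∉ Set.range g → F a = 0) :
    ∑ a, F a = ∑ a, F (g a) :=
  (Fintype.sum_of_injective g h.act_inj _ F hF fun _ => rfl).symm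

variable [Fintype S] [Fintype S']

theorem reachN_map (h : M.Embeds M' f g) {σ : Sched S A} {σ' : Sched S' A'}
    (hσ : ∀ (π : FinPath S A) a, σ' (π.map f g) (g a) = σ π a) (T : Set S') (n : ℕ)
    (π : FinPath S A) :
    M'.reachN σ' T n (π.map f g) = M.reachN σ (f ⁻¹' T) n π := by
  induction n generalizing π with
  | zero => simp only [reachN, FinPath.last_map, Set.mem_preimage]
  | succ n ih =>
    simp only [reachN, FinPath.last_map, Set.mem_preimage]
    congr 1
    rw [h.sum_act]
    · refine Finset.sum_congr rfl fun a _ => ?_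
      rw [hσ]
      congr 1
      rw [← Fintype.sum_of_injective f h.state_inj]
      · intro t ht
        rw [h.prob_of_notMem_range _ _ _ ht, zero_mul]
      · intro t
        rw [h.prob_map, ← FinPath.map_snoc, ih]
    · intro a ha
      simp [prob_eq_zero_of_not_enabled (h.not_enabled _ _ ha)]

theorem Pr_map (h : M.Embeds M' f g) {σ : Sched S A} {σ' : Sched S' A'}
    (hσ : ∀ (π : FinPath S A) a, σ' (π.map f g) (g a) = σ π a) (s : S) (T : Set S') :
    M'.Pr σ' (f s) T = M.Pr σ s (f ⁻¹' T) :=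
  iSup_congr fun n => h.reachN_map hσ T n ⟨s, []⟩

/-- Schedulers of the ambient MDP restrict to the embedded part. -/
theorem exists_sched_restrict (h : M.Embeds M' f g) {σ' : Sched S' A'} (hσ' : M'.IsSched σ') :
    ∃ σ : Sched S A, M.IsSched σ ∧ ∀ s T, M'.Pr σ' (f s) T = M.Pr σ s (f ⁻¹' T) := by
  refine ⟨fun π a => σ' (π.map f g) (g a), fun π hπ => ?_,
    fun s T => h.Pr_map (fun _ _ => rfl) s T⟩
  obtain ⟨h0, h1, h2⟩ := hσ' (π.map f g) ((h.consistent_map π).2 hπ)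
  rw [FinPath.last_map] at h1 h2
  refine ⟨fun a => h0 _, fun a ha => (h.enabled_map _ _).1 (h1 _ ha), fun ht => ?_⟩
  rw [← h2 (mt (h.terminal_map _).1 ht), h.sum_act]
  intro a ha
  by_contra hc
  exact h.not_enabled _ _ ha (h1 a hc)

/-- Schedulers of the embedded part extend to the ambient MDP. -/
theorem exists_sched_extend (h : M.Embeds M' f g) {σ : Sched S A} (hσ : M.IsSched σ) :
    ∃ σ' : Sched S' A', M'.IsSched σ' ∧ ∀ s T, M'.Pr σ' (f s) T = M.Pr σ s (f ⁻¹' T) := by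
  obtain ⟨τ, hτ⟩ := M'.exists_isSched
  have hinj := FinPath.map_injective h.state_inj h.act_inj
  let σ' : Sched S' A' :=
    Function.extend (FinPath.map f g) (fun π => Function.extend g (σ π) 0) τ
  have hmap : ∀ π : FinPath S A, σ' (π.map f g) = Function.extend g (σ π) 0 := fun π =>
    hinj.extend_apply _ _ π
  have hval : ∀ (π : FinPath S A) a, σ' (π.map f g) (g a) = σ π a := fun π a => by
    rw [hmap, h.act_inj.extend_apply]
  have hzero : ∀ (π : FinPath S A) a, a ∉ Set.range g → σ' (π.map f g) a = 0 := fun π a ha => by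
    rw [hmap, Function.extend_apply' _ _ _ ha, Pi.zero_apply]
  refine ⟨σ', fun π' hπ' => ?_, fun s T => h.Pr_map hval s T⟩
  by_cases hr : ∃ π, FinPath.map f g π = π'
  · obtain ⟨π, rfl⟩ := hr
    obtain ⟨h0, h1, h2⟩ := hσ π ((h.consistent_map π).1 hπ')
    rw [FinPath.last_map]
    refine ⟨fun a => ?_, fun a ha => ?_, fun ht => ?_⟩
    · by_cases hra : a ∈ Set.range g
      · obtain ⟨a, rfl⟩ := hra
        rw [hval]; exact h0 a
      · rw [hzero π a hra]
    · by_cases hra : a ∈ Set.range g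
      · obtain ⟨a, rfl⟩ := hra
        rw [hval] at ha
        exact (h.enabled_map _ _).2 (h1 a ha)
      · exact absurd (hzero π a hra) ha
    · rw [h.sum_act _ (hzero π), ← h2 (mt (h.terminal_map _).2 ht)]
      exact Finset.sum_congr rfl fun a _ => hval π a
  · have he : σ' π' = τ π' := Function.extend_apply' _ _ _ hr
    rw [he]
    exact hτ π' hπ'

end Embeds

end MDP

namespace OMDP

section Sum

variable {S₁ A₁ S₂ A₂ : Type}

theorem embeds_inl (𝒜 : OMDP S₁ A₁) (ℬ : OMDP S₂ A₂) :
    𝒜.M.Embeds (𝒜.sumComp ℬ).M Sum.inl Sum.inl where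
  state_inj := Sum.inl_injective
  act_inj := Sum.inl_injective
  prob_map s a t := by
    simp only [MDP.prob, sumComp]
    cases 𝒜.M.P s a <;> rfl
  prob_of_notMem_range s a t ht := by
    rcases t with t | t
    · exact absurd ⟨t, rfl⟩ ht
    rcases a with a | a
    · simp only [MDP.prob, sumComp]
      cases 𝒜.M.P s a <;> rfl
    · rfl
  enabled_map s a := by simp [MDP.enabled, sumComp]
  not_enabled s a ha := by
    rcases a with a | a
    · exact absurd ⟨a, rfl⟩ ha
    · simp [MDP.enabled, sumComp]

theorem embeds_inr (𝒜 : OMDP S₁ A₁) (ℬ : OMDP S₂ A₂) :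
    ℬ.M.Embeds (𝒜.sumComp ℬ).M Sum.inr Sum.inr where
  state_inj := Sum.inr_injective
  act_inj := Sum.inr_injective
  prob_map s a t := by
    simp only [MDP.prob, sumComp]
    cases ℬ.M.P s a <;> rfl
  prob_of_notMem_range s a t ht := by
    rcases t with t | t
    swap
    · exact absurd ⟨t, rfl⟩ ht
    rcases a with a | a
    · rfl
    · simp only [MDP.prob, sumComp]
      cases ℬ.M.P s a <;> rfl
  enabled_map s a := by simp [MDP.enabled, sumComp]
  not_enabled s a ha := by
    rcases a with a | a
    · simp [MDP.enabled, sumComp]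
    · exact absurd ⟨a, rfl⟩ ha

theorem inl_mem_exit_sumComp {𝒜 : OMDP S₁ A₁} {ℬ : OMDP S₂ A₂} {s : S₁} :
    Sum.inl s ∈ (𝒜.sumComp ℬ).exit ↔ s ∈ 𝒜.exit := by
  simp [exit, sumComp]

theorem inr_mem_exit_sumComp {𝒜 : OMDP S₁ A₁} {ℬ : OMDP S₂ A₂} {s : S₂} :
    Sum.inr s ∈ (𝒜.sumComp ℬ).exit ↔ s ∈ ℬ.exit := by
  simp [exit, sumComp]

theorem inl_mem_entr_sumComp {𝒜 : OMDP S₁ A₁} {ℬ : OMDP S₂ A₂} {s : S₁} :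
    Sum.inl s ∈ (𝒜.sumComp ℬ).entr ↔ s ∈ 𝒜.entr := by
  simp [entr, sumComp]

theorem inr_mem_entr_sumComp {𝒜 : OMDP S₁ A₁} {ℬ : OMDP S₂ A₂} {s : S₂} :
    Sum.inr s ∈ (𝒜.sumComp ℬ).entr ↔ s ∈ ℬ.entr := by
  simp [entr, sumComp]

end Sum

section Shortcut

variable {S A : Type} {𝒜 : OMDP S A} {B : 𝒜.EntrIdx → Finset (𝒜.ExitIdx → ℝ)}

theorem shortcut_enabled_iff (k : 𝒜.EntrIdx) (a : ShortAct 𝒜 B) :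
    (𝒜.shortcut B).M.enabled (some k.1) a ↔ a.1 ∈ B k := by
  simp [MDP.enabled, shortcut, k.2]

theorem shortcut_terminal_none : (𝒜.shortcut B).M.terminal none := fun _ => rfl

theorem shortcut_terminal_of_notMem_entr {s : S} (hs : s ∉ 𝒜.entr) :
    (𝒜.shortcut B).M.terminal (some s) := by
  intro a
  simp [shortcut, hs]

theorem shortcut_prob_exit (k : 𝒜.EntrIdx) (a : ShortAct 𝒜 B) (j : 𝒜.ExitIdx) :
    (𝒜.shortcut B).M.prob (some k.1) a (some j.1) = if a.1 ∈ B k then a.1 j else 0 := by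
  by_cases h : a.1 ∈ B k
  · simp [MDP.prob, shortcut, k.2, h, Subtype.coe_inj]
  · simp [MDP.prob, shortcut, k.2, h]

theorem shortcut_prob_eq_zero (k : 𝒜.EntrIdx) (a : ShortAct 𝒜 B) {s : S} (hs : s ∉ 𝒜.exit) :
    (𝒜.shortcut B).M.prob (some k.1) a (some s) = 0 := by
  by_cases h : a.1 ∈ B k
  · have h0 : ∀ j : 𝒜.ExitIdx, j.1 ≠ s := fun j hj => hs (hj ▸ j.2)
    simp [MDP.prob, shortcut, k.2, h, h0]
  · simp [MDP.prob, shortcut, k.2, h]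

variable [Fintype S]

theorem WF.notMem_exit (h : 𝒜.WF) {s : S} (hs : s ∈ 𝒜.entr) : s ∉ 𝒜.exit := by
  have h' := h.2.1
  rw [List.append_assoc, List.nodup_append] at h'
  exact fun he => h'.2.2 s hs s he rfl

theorem sum_shortAct {V : Type} [AddCommMonoid V] (k : 𝒜.EntrIdx) (G : (𝒜.ExitIdx → ℝ) → V) :
    (∑ a : ShortAct 𝒜 B, if a.1 ∈ B k then G a.1 else 0) = ∑ y ∈ B k, G y := by
  rw [← Finset.sum_filter]
  refine Finset.sum_nbij Subtype.val ?_ ?_ ?_ ?_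
  · intro a ha
    exact (Finset.mem_filter.1 ha).2
  · exact Subtype.val_injective.injOn
  · intro y hy
    exact ⟨⟨y, k, hy⟩, by simpa using hy, rfl⟩
  · intro _ _
    rfl

theorem shortcut_Pr (hWF : 𝒜.WF) (hB : ∀ k, ∀ p ∈ B k, Subdist p)
    {σ : Sched (Option S) (ShortAct 𝒜 B)} (hσ : (𝒜.shortcut B).M.IsSched σ) (k : 𝒜.EntrIdx)
    (j : 𝒜.ExitIdx) :
    (𝒜.shortcut B).M.Pr σ (some k.1) {some j.1} =
      ∑ a : ShortAct 𝒜 B, if a.1 ∈ B k then σ ⟨some k.1, []⟩ a * a.1 j else 0 := by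
  have hsum : ∑ a : ShortAct 𝒜 B, σ ⟨some k.1, []⟩ a *
      (𝒜.shortcut B).M.prob (some k.1) a (some j.1) =
      ∑ a : ShortAct 𝒜 B, if a.1 ∈ B k then σ ⟨some k.1, []⟩ a * a.1 j else 0 := by
    simp only [shortcut_prob_exit, mul_ite, mul_zero]
  rw [← hsum]
  apply MDP.Pr_eq_sum_of_successors_terminal
  · intro h
    apply hWF.notMem_exit k.2
    rw [Option.some_injective _ h]
    exact j.2
  · intro a s' h
    rcases s' with _ | s'
    · exact shortcut_terminal_none
    · apply shortcut_terminal_of_notMem_entr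
      intro he
      exact h (shortcut_prob_eq_zero k a (hWF.notMem_exit he))
  · rw [hsum]
    refine Finset.sum_nonneg fun a _ => ?_
    split_ifs with h
    · exact mul_nonneg ((hσ ⟨some k.1, []⟩ trivial).1 a) ((hB k _ h).1 j)
    · exact le_rfl

/-- Reachability vectors from an entrance of a shortcut lie in the convex hull of its actions. -/
theorem shortcut_Pr_mem_convexHull (hWF : 𝒜.WF) (hB : ∀ k, ∀ p ∈ B k, Subdist p)
    {σ : Sched (Option S) (ShortAct 𝒜 B)} (hσ : (𝒜.shortcut B).M.IsSched σ) (k : 𝒜.EntrIdx)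
    (hne : (B k).Nonempty) :
    (fun j : 𝒜.ExitIdx => (𝒜.shortcut B).M.Pr σ (some k.1) {some j.1}) ∈
      convexHull ℝ (B k : Set (𝒜.ExitIdx → ℝ)) := by
  obtain ⟨h0, h1, h2⟩ := hσ ⟨some k.1, []⟩ trivial
  change ∀ a, _ → (𝒜.shortcut B).M.enabled (some k.1) a at h1
  change ¬(𝒜.shortcut B).M.terminal (some k.1) → _ at h2
  let w : (𝒜.ExitIdx → ℝ) → ℝ := fun y =>
    if h : ∃ i, y ∈ B i then σ ⟨some k.1, []⟩ ⟨y, h⟩ else 0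
  have hw : ∀ a : ShortAct 𝒜 B, w a.1 = σ ⟨some k.1, []⟩ a := fun a => dif_pos a.2
  rw [Finset.mem_convexHull']
  refine ⟨w, fun y hy => ?_, ?_, ?_⟩
  · rw [hw ⟨y, k, hy⟩]
    exact h0 _
  · rw [← sum_shortAct]
    obtain ⟨y, hy⟩ := hne
    have hnt : ¬(𝒜.shortcut B).M.terminal (some k.1) := fun ht =>
      (shortcut_enabled_iff k ⟨y, k, hy⟩).2 hy (ht _)
    rw [← h2 hnt]
    refine Finset.sum_congr rfl fun a _ => ?_
    rw [hw]
    split_ifs with h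
    · rfl
    · by_contra hc
      exact h ((shortcut_enabled_iff k a).1 (h1 a (Ne.symm hc)))
  · rw [← sum_shortAct]
    ext j
    rw [shortcut_Pr hWF hB hσ, Finset.sum_apply]
    refine Finset.sum_congr rfl fun a _ => ?_
    rw [hw]
    split_ifs <;> rfl

/-- Every point of the convex hull of the actions of an entrance is a reachability vector. -/
theorem exists_sched_shortcut (hWF : 𝒜.WF) (hB : ∀ k, ∀ p ∈ B k, Subdist p) (k : 𝒜.EntrIdx)
    {q : 𝒜.ExitIdx → ℝ} (hq : q ∈ convexHull ℝ (B k : Set (𝒜.ExitIdx → ℝ))) :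
    ∃ σ, (𝒜.shortcut B).M.IsSched σ ∧
      ∀ j : 𝒜.ExitIdx, (𝒜.shortcut B).M.Pr σ (some k.1) {some j.1} = q j := by
  obtain ⟨w, hw0, hw1, hwq⟩ := Finset.mem_convexHull'.1 hq
  obtain ⟨τ, hτ⟩ := (𝒜.shortcut B).M.exists_isSched
  let σ : Sched (Option S) (ShortAct 𝒜 B) := fun π a =>
    if π.last = some k.1 then (if a.1 ∈ B k then w a.1 else 0) else τ π a
  have hσ : (𝒜.shortcut B).M.IsSched σ := by
    intro π hπ
    by_cases hl : π.last = some k.1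
    · have hσπ : σ π = fun a => if a.1 ∈ B k then w a.1 else 0 := funext fun a => if_pos hl
      rw [hσπ, hl]
      refine ⟨fun a => ?_, fun a ha => ?_, fun _ => ?_⟩
      · dsimp only
        split_ifs with h
        · exact hw0 _ h
        · exact le_rfl
      · rw [shortcut_enabled_iff]
        by_contra hc
        exact ha (if_neg hc)
      · rw [sum_shortAct, hw1]
    · have hσπ : σ π = τ π := funext fun a => if_neg hl
      rw [hσπ]
      exact hτ π hπ
  refine ⟨σ, hσ, fun j => ?_⟩
  have hσk : ∀ a, σ ⟨some k.1, []⟩ a = if a.1 ∈ B k then w a.1 else 0 := fun a => if_pos rfl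
  rw [shortcut_Pr hWF hB hσ, ← hwq, ← sum_shortAct (B := B), Finset.sum_apply]
  refine Finset.sum_congr rfl fun a _ => ?_
  rw [hσk]
  split_ifs <;> rfl

theorem shortcut_Pr_of_empty (hWF : 𝒜.WF) (hB : ∀ k, ∀ p ∈ B k, Subdist p)
    {σ : Sched (Option S) (ShortAct 𝒜 B)} (hσ : (𝒜.shortcut B).M.IsSched σ) (k : 𝒜.EntrIdx)
    (he : B k = ∅) (j : 𝒜.ExitIdx) :
    (𝒜.shortcut B).M.Pr σ (some k.1) {some j.1} = 0 := by
  simp [shortcut_Pr hWF hB hσ, he]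

end Shortcut

section Component

variable {S A S' A' S'' A'' : Type} [Fintype S] [Fintype A] [Fintype S'] [Fintype A']
  [Fintype S''] [Fintype A''] {𝒜 : OMDP S A} {B : 𝒜.EntrIdx → Finset (𝒜.ExitIdx → ℝ)}
  {𝒳 : OMDP S' A'} {𝒴 : OMDP S'' A''} {f : S → S'} {g : A → A'}
  {f' : Option S → S''} {g' : ShortAct 𝒜 B → A''} {φ : S' → S''}

/-- Replacing a component of an open MDP by its shortcut along an under-approximation
only yields achievable points. -/
theorem pullExit_achievable_subset (hWF : 𝒜.WF) (hB : ∀ k, ∀ p ∈ B k, Subdist p)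
    (h : 𝒜.M.Embeds 𝒳.M f g) (h' : (𝒜.shortcut B).M.Embeds 𝒴.M f' g')
    (hexit : ∀ s, f s ∈ 𝒳.exit → s ∈ 𝒜.exit) (hφ : ∀ s, φ (f s) = f' (some s))
    (hr : ∀ x, x ∉ Set.range f → φ x ∉ Set.range f')
    (hmem : ∀ s ∈ 𝒳.exit, φ s ∈ 𝒴.exit) (k : 𝒜.EntrIdx)
    (hsound : dwConv (B k : Set (𝒜.ExitIdx → ℝ)) ⊆ 𝒜.achievable k.1) :
    pullExit 𝒳 𝒴 φ hmem '' 𝒴.achievable (φ (f k.1)) ⊆ 𝒳.achievable (f k.1) := by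
  rintro _ ⟨p, ⟨σ', hσ', hp⟩, rfl⟩
  obtain ⟨σ, hσ, hPr⟩ := h'.exists_sched_restrict hσ'
  have key : ∃ τ, 𝒜.M.IsSched τ ∧ ∀ j : 𝒜.ExitIdx,
      (𝒜.shortcut B).M.Pr σ (some k.1) {some j.1} ≤ 𝒜.M.Pr τ k.1 {j.1} := by
    rcases (B k).eq_empty_or_nonempty with he | hne
    · obtain ⟨τ, hτ⟩ := 𝒜.M.exists_isSched
      refine ⟨τ, hτ, fun j => ?_⟩
      rw [shortcut_Pr_of_empty hWF hB hσ k he]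
      exact MDP.Pr_nonneg ..
    · exact hsound ⟨_, shortcut_Pr_mem_convexHull hWF hB hσ k hne, le_rfl⟩
  obtain ⟨τ, hτ, hle⟩ := key
  obtain ⟨τ', hτ', hPrτ⟩ := h.exists_sched_extend hτ
  refine ⟨τ', hτ', fun j => ?_⟩
  refine (hp _).trans ?_
  change 𝒴.M.Pr σ' (φ (f k.1)) {φ j.1} ≤ 𝒳.M.Pr τ' (f k.1) {j.1}
  by_cases hj : j.1 ∈ Set.range f
  · obtain ⟨s, hs⟩ := hj
    have hse : s ∈ 𝒜.exit := hexit s (hs ▸ j.2)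
    rw [← hs, hφ, hφ, hPr, hPrτ, h.preimage_singleton, h'.preimage_singleton]
    exact hle ⟨s, hse⟩
  · rw [hφ, hPr, Set.preimage_singleton_eq_empty.2 (hr _ hj), MDP.Pr_empty]
    exact MDP.Pr_nonneg ..

/-- Replacing a component of an open MDP by its shortcut along an over-approximation
preserves achievable points. -/
theorem achievable_subset_pullExit (hWF : 𝒜.WF) (hB : ∀ k, ∀ p ∈ B k, Subdist p)
    (h : 𝒜.M.Embeds 𝒳.M f g) (h' : (𝒜.shortcut B).M.Embeds 𝒴.M f' g')
    (hexit : ∀ s, f s ∈ 𝒳.exit → s ∈ 𝒜.exit) (hφ : ∀ s, φ (f s) = f' (some s))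
    (hinj : Function.Injective φ) (hmem : ∀ s ∈ 𝒳.exit, φ s ∈ 𝒴.exit) (k : 𝒜.EntrIdx)
    (hsound : 𝒜.achievable k.1 ⊆ dwConv (B k : Set (𝒜.ExitIdx → ℝ))) :
    𝒳.achievable (f k.1) ⊆ pullExit 𝒳 𝒴 φ hmem '' 𝒴.achievable (φ (f k.1)) := by
  rintro p ⟨τ', hτ', hp⟩
  obtain ⟨τ, hτ, hPrτ⟩ := h.exists_sched_restrict hτ'
  obtain ⟨q, hq, hle⟩ := hsound ⟨τ, hτ, le_rfl⟩
  obtain ⟨σ, hσ, hσq⟩ := exists_sched_shortcut hWF hB k hq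
  obtain ⟨σ', hσ', hPr⟩ := h'.exists_sched_extend hσ
  let e : 𝒳.ExitIdx → 𝒴.ExitIdx := fun j => ⟨φ j.1, hmem j.1 j.2⟩
  have he : Function.Injective e := fun _ _ hab =>
    Subtype.ext (hinj (congrArg Subtype.val hab))
  refine ⟨Function.extend e p (𝒴.prVec σ' (φ (f k.1))), ⟨σ', hσ', fun x => ?_⟩,
    funext fun j => he.extend_apply _ _ j⟩
  by_cases hx : ∃ j, e j = x
  · obtain ⟨j, rfl⟩ := hx
    rw [he.extend_apply]
    refine (hp j).trans ?_
    change 𝒳.M.Pr τ' (f k.1) {j.1} ≤ 𝒴.M.Pr σ' (φ (f k.1)) {φ j.1}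
    by_cases hj : j.1 ∈ Set.range f
    · obtain ⟨s, hs⟩ := hj
      have hse : s ∈ 𝒜.exit := hexit s (hs ▸ j.2)
      rw [← hs, hφ, hφ, hPr, hPrτ, h.preimage_singleton,
        h'.preimage_singleton, hσq ⟨s, hse⟩]
      exact hle ⟨s, hse⟩
    · rw [hPrτ, Set.preimage_singleton_eq_empty.2 hj, MDP.Pr_empty]
      exact MDP.Pr_nonneg ..
  · rw [Function.extend_apply' _ _ _ hx]

end Component

end OMDP

end SD

open SD in
/-- Let `𝒜`, `ℬ` be open MDPs and `(L^𝒜,U^𝒜)`, `(L^ℬ,U^ℬ)` sound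
approximations of `𝒜` and `ℬ` (given by vertex families of subdistributions).
Then the achievable sets of `D(L^𝒜) ⊕ D(L^ℬ)` and of `D(U^𝒜) ⊕ D(U^ℬ)` form a
sound approximation of the sum `𝒜 ⊕ ℬ`: for every entrance `i` of `𝒜 ⊕ ℬ`,
`A^{D(L^𝒜)⊕D(L^ℬ)}(i) ⊆ A^{𝒜⊕ℬ}(i) ⊆ A^{D(U^𝒜)⊕D(U^ℬ)}(i)` (achievable sets of
the shortcut sums transported along `s ↦ Sum.map some some s`). -/
theorem statement_8 {S₁ A₁ S₂ A₂ : Type}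
    [Fintype S₁] [Fintype A₁] [Fintype S₂] [Fintype A₂]
    (𝒜 : OMDP S₁ A₁) (ℬ : OMDP S₂ A₂) (hWFA : 𝒜.WF) (hWFB : ℬ.WF)
    (VLA VUA : 𝒜.EntrIdx → Finset (𝒜.ExitIdx → ℝ))
    (VLB VUB : ℬ.EntrIdx → Finset (ℬ.ExitIdx → ℝ))
    (hVLA : ∀ k, ∀ p ∈ VLA k, Subdist p) (hVUA : ∀ k, ∀ p ∈ VUA k, Subdist p)
    (hVLB : ∀ k, ∀ p ∈ VLB k, Subdist p) (hVUB : ∀ k, ∀ p ∈ VUB k, Subdist p)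
    (hsoundA : ∀ k : 𝒜.EntrIdx,
      dwConv ((VLA k : Finset (𝒜.ExitIdx → ℝ)) : Set (𝒜.ExitIdx → ℝ)) ⊆ 𝒜.achievable k.1 ∧
        𝒜.achievable k.1 ⊆ dwConv ((VUA k : Finset (𝒜.ExitIdx → ℝ)) : Set (𝒜.ExitIdx → ℝ)))
    (hsoundB : ∀ k : ℬ.EntrIdx,
      dwConv ((VLB k : Finset (ℬ.ExitIdx → ℝ)) : Set (ℬ.ExitIdx → ℝ)) ⊆ ℬ.achievable k.1 ∧
        ℬ.achievable k.1 ⊆ dwConv ((VUB k : Finset (ℬ.ExitIdx → ℝ)) : Set (ℬ.ExitIdx → ℝ)))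
    (hmemL : ∀ s ∈ (𝒜.sumComp ℬ).exit,
      Sum.map some some s ∈ ((𝒜.shortcut VLA).sumComp (ℬ.shortcut VLB)).exit)
    (hmemU : ∀ s ∈ (𝒜.sumComp ℬ).exit,
      Sum.map some some s ∈ ((𝒜.shortcut VUA).sumComp (ℬ.shortcut VUB)).exit)
    (i : S₁ ⊕ S₂) (hi : i ∈ (𝒜.sumComp ℬ).entr) :
    pullExit (𝒜.sumComp ℬ) ((𝒜.shortcut VLA).sumComp (ℬ.shortcut VLB))
        (Sum.map some some) hmemL ''
        ((𝒜.shortcut VLA).sumComp (ℬ.shortcut VLB)).achievable (Sum.map some some i) ⊆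
      (𝒜.sumComp ℬ).achievable i ∧
    (𝒜.sumComp ℬ).achievable i ⊆
      pullExit (𝒜.sumComp ℬ) ((𝒜.shortcut VUA).sumComp (ℬ.shortcut VUB))
        (Sum.map some some) hmemU ''
        ((𝒜.shortcut VUA).sumComp (ℬ.shortcut VUB)).achievable (Sum.map some some i) := by
  have hinj : Function.Injective (Sum.map (some : S₁ → Option S₁) (some : S₂ → Option S₂)) :=
    Sum.map_injective.2 ⟨Option.some_injective _, Option.some_injective _⟩
  rcases i with i | i
  · have hi' := OMDP.inl_mem_entr_sumComp.1 hi
    refine ⟨?_, ?_⟩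
    · exact OMDP.pullExit_achievable_subset hWFA hVLA (OMDP.embeds_inl 𝒜 ℬ)
        (OMDP.embeds_inl _ _) (fun s => OMDP.inl_mem_exit_sumComp.1) (fun s => rfl)
        (by rintro (x | x) <;> simp) hmemL ⟨i, hi'⟩ (hsoundA ⟨i, hi'⟩).1
    · exact OMDP.achievable_subset_pullExit hWFA hVUA (OMDP.embeds_inl 𝒜 ℬ)
        (OMDP.embeds_inl _ _) (fun s => OMDP.inl_mem_exit_sumComp.1) (fun s => rfl)
        hinj hmemU ⟨i, hi'⟩ (hsoundA ⟨i, hi'⟩).2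
  · have hi' := OMDP.inr_mem_entr_sumComp.1 hi
    refine ⟨?_, ?_⟩
    · exact OMDP.pullExit_achievable_subset hWFB hVLB (OMDP.embeds_inr 𝒜 ℬ)
        (OMDP.embeds_inr _ _) (fun s => OMDP.inr_mem_exit_sumComp.1) (fun s => rfl)
        (by rintro (x | x) <;> simp) hmemL ⟨i, hi'⟩ (hsoundB ⟨i, hi'⟩).1
    · exact OMDP.achievable_subset_pullExit hWFB hVUB (OMDP.embeds_inr 𝒜 ℬ)
        (OMDP.embeds_inr _ _) (fun s => OMDP.inr_mem_exit_sumComp.1) (fun s => rfl)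
        hinj hmemU ⟨i, hi'⟩ (hsoundB ⟨i, hi'⟩).2
end
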